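/- A polynomial h ∈ ℝ[s,t] satisfies h(a,b) ≥ 0 for all a ∈ [0,1] and all b ∈ ℝ if and only if there exist sums of squares σ_1, σ_2 ∈ ℝ[s,t] such that h = σ_1 + σ_2·s(1−s). -/

import Mathlib

section Part1

open Polynomial

namespace Strip

/-- Membership in the preordering generated by `x(1-x)`. -/
def InQ (f : ℝ[X][X]) : Prop :=
  ∃ σ₁ σ₂ : ℝ[X][X], IsSumSq σ₁ ∧ IsSumSq σ₂ ∧ f = σ₁ + σ₂ * C (X * (1 - X))

theorem InQ.of_sumSq {f : ℝ[X][X]} (h : IsSumSq f) : InQ f :=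
  ⟨f, 0, h, IsSumSq.zero, by simp⟩

theorem InQ.sq (f : ℝ[X][X]) : InQ (f ^ 2) := InQ.of_sumSq (by rw [pow_two]; exact IsSumSq.mul_self f)

theorem InQ.zero : InQ 0 := InQ.of_sumSq IsSumSq.zero
theorem InQ.one : InQ 1 := InQ.of_sumSq IsSumSq.one

theorem InQ.q : InQ (C (X * (1 - X))) := ⟨0, 1, IsSumSq.zero, IsSumSq.one, by simp⟩

theorem InQ.add {f g : ℝ[X][X]} (hf : InQ f) (hg : InQ g) : InQ (f + g) := by
  obtain ⟨a, b, ha, hb, rfl⟩ := hf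
  obtain ⟨c, d, hc, hd, rfl⟩ := hg
  exact ⟨a + c, b + d, ha.add hc, hb.add hd, by ring⟩

theorem InQ.mul {f g : ℝ[X][X]} (hf : InQ f) (hg : InQ g) : InQ (f * g) := by
  obtain ⟨a, b, ha, hb, rfl⟩ := hf
  obtain ⟨c, d, hc, hd, rfl⟩ := hg
  refine ⟨a * c + b * d * (C (X * (1 - X)) * C (X * (1 - X))), a * d + b * c,
    (ha.mul hc).add ((hb.mul hd).mul (IsSumSq.mul_self _)), (ha.mul hd).add (hb.mul hc), by ring⟩

theorem InQ.sum {ι : Type*} (s : Finset ι) (f : ι → ℝ[X][X]) (h : ∀ i ∈ s, InQ (f i)) :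
    InQ (∑ i ∈ s, f i) := by
  classical
  induction s using Finset.induction_on with
  | empty => simpa using InQ.zero
  | insert a s ha ih =>
    rw [Finset.sum_insert ha]
    exact (h a (by simp)).add (ih fun i hi => h i (by simp [hi]))

theorem InQ.pow {f : ℝ[X][X]} (hf : InQ f) (n : ℕ) : InQ (f ^ n) := by
  induction n with
  | zero => simpa using InQ.one
  | succ n ih => rw [pow_succ]; exact ih.mul hf

theorem InQ.CX : InQ (C X) := by
  have : (C X : ℝ[X][X]) = (C X) ^ 2 + C (X * (1 - X)) := by
    rw [← C_pow, ← C_add]; congr 1; ring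
  rw [this]; exact (InQ.sq _).add InQ.q

theorem InQ.C1X : InQ (C (1 - X)) := by
  have : (C (1 - X) : ℝ[X][X]) = (C (1 - X)) ^ 2 + C (X * (1 - X)) := by
    rw [← C_pow, ← C_add]; congr 1; ring
  rw [this]; exact (InQ.sq _).add InQ.q

theorem InQ.const {c : ℝ} (hc : 0 ≤ c) : InQ (C (C c)) := by
  have : (C (C c) : ℝ[X][X]) = (C (C (Real.sqrt c))) ^ 2 := by
    rw [← C_pow, ← C_pow, Real.sq_sqrt hc]
  rw [this]; exact InQ.sq _

theorem isSumSq_nonneg {f : ℝ[X][X]} (hf : IsSumSq f) (x y : ℝ) : 0 ≤ f.evalEval x y := by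
  induction hf with
  | zero => simp
  | sq_add a h ih => rw [evalEval_add, evalEval_mul]; nlinarith [mul_self_nonneg (a.evalEval x y)]

theorem InQ.nonneg {f : ℝ[X][X]} (hf : InQ f) {x : ℝ} (hx : x ∈ Set.Icc (0:ℝ) 1) (y : ℝ) :
    0 ≤ f.evalEval x y := by
  obtain ⟨a, b, ha, hb, rfl⟩ := hf
  have h1 := isSumSq_nonneg ha x y
  have h2 := isSumSq_nonneg hb x y
  simp only [evalEval_add, evalEval_mul, evalEval_C, eval_mul, eval_X, eval_sub, eval_one]
  have := mul_nonneg hx.1 (sub_nonneg.2 hx.2)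
  nlinarith [mul_nonneg h2 this]

theorem nonneg_of_dense {S : Set ℝ} (hS : S ⊆ closure (interior S)) {w r : ℝ[X]} (hw : w ≠ 0)
    (h : ∀ x ∈ S, w.eval x ≠ 0 → 0 ≤ r.eval x) : ∀ x ∈ S, 0 ≤ r.eval x := by
  intro x hx
  have hfin : {x | w.eval x = 0}.Finite := by
    refine (w.roots.toFinset.finite_toSet).subset ?_
    intro z hz
    simpa [hw] using hz
  have hd : Dense {x | w.eval x = 0}ᶜ := hfin.countable.dense_compl ℝ
  have h1 : x ∈ closure (interior S ∩ {x | w.eval x = 0}ᶜ) :=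
    closure_minimal (hd.open_subset_closure_inter isOpen_interior) isClosed_closure (hS hx)
  have hc : IsClosed {x | 0 ≤ r.eval x} := isClosed_le continuous_const r.continuous
  exact closure_minimal (fun z hz => h z (interior_subset hz.1) hz.2) hc h1

theorem root_interior {S : Set ℝ} {r : ℝ[X]} {a : ℝ} (ha : a ∈ interior S)
    (h : ∀ x ∈ S, 0 ≤ ((X - C a) * r).eval x) : r.eval a = 0 := by
  by_contra hne
  have hc := r.continuous.continuousAt (x := a)
  rcases lt_or_gt_of_ne hne with hl | hl
  · have h1 : ∀ᶠ x in nhds a, r.eval x < 0 := hc.eventually (gt_mem_nhds hl)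
    have h2 : ∀ᶠ x in nhdsWithin a (Set.Ioi a), r.eval x < 0 ∧ x ∈ S ∧ a < x :=
      (h1.filter_mono nhdsWithin_le_nhds).and
        ((Filter.Eventually.filter_mono nhdsWithin_le_nhds (p := fun x => x ∈ S)
          (mem_interior_iff_mem_nhds.1 ha)).and self_mem_nhdsWithin)
    obtain ⟨x, hx1, hx2, hx3⟩ := h2.exists
    have := h x hx2
    simp only [eval_mul, eval_sub, eval_X, eval_C] at this
    nlinarith
  · have h1 : ∀ᶠ x in nhds a, 0 < r.eval x := hc.eventually (lt_mem_nhds hl)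
    have h2 : ∀ᶠ x in nhdsWithin a (Set.Iio a), 0 < r.eval x ∧ x ∈ S ∧ x < a :=
      (h1.filter_mono nhdsWithin_le_nhds).and
        ((Filter.Eventually.filter_mono nhdsWithin_le_nhds (p := fun x => x ∈ S)
          (mem_interior_iff_mem_nhds.1 ha)).and self_mem_nhdsWithin)
    obtain ⟨x, hx1, hx2, hx3⟩ := h2.exists
    have := h x hx2
    simp only [eval_mul, eval_sub, eval_X, eval_C] at this
    nlinarith

/-- factorization principle for univariate polynomials nonneg on a set `S` -/
theorem univ_induct {S : Set ℝ} (hS : S ⊆ closure (interior S)) (hne : S.Nonempty)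
    (P : ℝ[X] → Prop)
    (hmul : ∀ p q, P p → P q → P (p * q)) (hadd : ∀ p q, P p → P q → P (p + q))
    (hsq : ∀ p, P (p ^ 2))
    (hlin : ∀ a, a ∉ interior S → ∃ ε : ℝ, ε ^ 2 = 1 ∧ P (C ε * (X - C a)) ∧ ∀ x ∈ S, 0 ≤ ε * (x - a)) :
    ∀ p : ℝ[X], (∀ x ∈ S, 0 ≤ p.eval x) → P p := by
  intro p
  induction hn : p.natDegree using Nat.strong_induction_on generalizing p with
  | _ n ih =>
  intro hp
  by_cases hp0 : p = 0
  · have := hsq 0; simpa [hp0] using this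
  by_cases hn0 : n = 0
  · rw [eq_C_of_natDegree_eq_zero (hn.trans hn0)] at hp ⊢
    obtain ⟨x, hx⟩ := hne
    have := hp x hx
    rw [eval_C] at this
    have h2 := hsq (C (Real.sqrt (p.coeff 0)))
    rwa [← C_pow, Real.sq_sqrt this] at h2
  by_cases hr : ∃ a, p.eval a = 0
  · obtain ⟨a, ha⟩ := hr
    obtain ⟨r, rfl⟩ := dvd_iff_isRoot.2 ha
    have hr0 : r ≠ 0 := right_ne_zero_of_mul hp0
    have hdeg : r.natDegree + 1 = n := by
      rw [← hn, natDegree_mul (X_sub_C_ne_zero a) hr0, natDegree_X_sub_C, add_comm]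
    by_cases hai : a ∈ interior S
    · have := root_interior hai hp
      obtain ⟨s, rfl⟩ := dvd_iff_isRoot.2 this
      have hs0 : s ≠ 0 := right_ne_zero_of_mul hr0
      have hdeg2 : s.natDegree + 1 + 1 = n := by
        rw [← hdeg, natDegree_mul (X_sub_C_ne_zero a) hs0, natDegree_X_sub_C, add_comm 1]
      rw [← mul_assoc, ← pow_two]
      refine hmul _ _ (hsq _) (ih _ (by omega) s rfl ?_)
      refine nonneg_of_dense hS (X_sub_C_ne_zero a) ?_
      intro x hx hxa
      have := hp x hx
      rw [← mul_assoc, ← pow_two, eval_mul, eval_pow] at this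
      exact nonneg_of_mul_nonneg_right this (by positivity)
    · obtain ⟨ε, he, hP, hpos⟩ := hlin a hai
      have e1 : (X - C a) * r = (C ε * (X - C a)) * (C ε * r) := by
        have : (C ε : ℝ[X]) ^ 2 = 1 := by rw [← C_pow, he, C_1]
        linear_combination -(X - C a) * r * this
      have hε : ε ≠ 0 := by rintro rfl; norm_num at he
      rw [e1]
      refine hmul _ _ hP (ih _ (by omega) (C ε * r) (natDegree_C_mul hε) ?_)
      refine nonneg_of_dense hS (X_sub_C_ne_zero a) ?_
      intro x hx hxa
      have := hp x hx
      rw [e1, eval_mul] at this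
      have h3 := hpos x hx
      simp only [eval_mul, eval_sub, eval_X, eval_C] at this hxa ⊢
      exact nonneg_of_mul_nonneg_right this (lt_of_le_of_ne h3 (mul_ne_zero hε hxa).symm)
  · push Not at hr
    have hd : 0 < (p.map (algebraMap ℝ ℂ)).degree := by
      rw [degree_map]; exact natDegree_pos_iff_degree_pos.1 (by omega)
    obtain ⟨z, hz⟩ := Complex.exists_root hd
    have hz' : aeval z p = 0 := by
      rwa [IsRoot, eval_map_algebraMap] at hz
    have him : z.im ≠ 0 := by
      intro h0
      apply hr z.re
      have : z = (z.re : ℂ) := by apply Complex.ext <;> simp [h0]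
      rw [this] at hz'
      have h5 : aeval ((algebraMap ℝ ℂ) z.re) p = 0 := hz'
      rw [aeval_algebraMap_apply] at h5
      simpa using h5
    obtain ⟨s, hs⟩ := Polynomial.quadratic_dvd_of_aeval_eq_zero_im_ne_zero p hz' him
    have e1 : (X ^ 2 - C (2 * z.re) * X + C (‖z‖ ^ 2) : ℝ[X]) = (X - C z.re) ^ 2 + (C z.im) ^ 2 := by
      rw [← Complex.normSq_eq_norm_sq, Complex.normSq_apply]
      simp only [C_add, C_mul, map_ofNat]
      ring
    rw [e1] at hs
    have hev : ∀ x, 0 < ((X - C z.re) ^ 2 + (C z.im) ^ 2 : ℝ[X]).eval x := by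
      intro x; simp only [eval_add, eval_pow, eval_sub, eval_X, eval_C]; positivity
    have hq0 : ((X - C z.re) ^ 2 + (C z.im) ^ 2 : ℝ[X]) ≠ 0 := by
      intro h; have := hev 0; rw [h] at this; simp at this
    have hqd : ((X - C z.re) ^ 2 + (C z.im) ^ 2 : ℝ[X]).natDegree = 2 := by
      rw [← C_pow, natDegree_add_C, natDegree_pow, natDegree_X_sub_C]
    have hs0 : s ≠ 0 := by rintro rfl; exact hp0 (by simpa using hs)
    have hdeg : 2 + s.natDegree = n := by
      rw [← hn, hs, natDegree_mul hq0 hs0, hqd]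
    rw [hs]
    refine hmul _ _ (hadd _ _ (hsq _) (hsq _)) (ih _ (by omega) s rfl ?_)
    intro x hx
    have := hp x hx
    rw [hs, eval_mul] at this
    exact nonneg_of_mul_nonneg_right this (hev x)

theorem univ_real (p : ℝ[X]) (hp : ∀ x, 0 ≤ p.eval x) : IsSumSq p := by
  refine univ_induct (S := Set.univ) (by simp) (by simp) IsSumSq (fun _ _ => IsSumSq.mul)
    (fun _ _ => IsSumSq.add) (fun p => by rw [pow_two]; exact IsSumSq.mul_self p) ?_ p
    (fun x _ => hp x)
  intro a ha; simp at ha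

theorem univ_unit (p : ℝ[X]) (hp : ∀ x ∈ Set.Icc (0:ℝ) 1, 0 ≤ p.eval x) : InQ (C p) := by
  refine univ_induct (S := Set.Icc (0:ℝ) 1) (by rw [interior_Icc, closure_Ioo (by norm_num)])
    ⟨0, by simp⟩ (fun p => InQ (C p)) ?_ ?_ ?_ ?_ p hp
  · intro p q h1 h2; rw [C_mul]; exact h1.mul h2
  · intro p q h1 h2; rw [C_add]; exact h1.add h2
  · intro p; rw [C_pow]; exact InQ.sq _
  · intro a ha
    rw [interior_Icc, Set.mem_Ioo, not_and_or, not_lt, not_lt] at ha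
    rcases ha with ha | ha
    · refine ⟨1, by norm_num, ?_, ?_⟩
      · have : (C (C 1 * (X - C a)) : ℝ[X][X]) = C X + C (C (-a)) := by
          rw [← C_add]; congr 1; simp; ring
        rw [this]; exact InQ.CX.add (InQ.const (by linarith))
      · rintro x ⟨h1, h2⟩; linarith
    · refine ⟨-1, by norm_num, ?_, ?_⟩
      · have : (C (C (-1) * (X - C a)) : ℝ[X][X]) = C (1 - X) + C (C (a - 1)) := by
          rw [← C_add]; congr 1; simp
        rw [this]; exact InQ.C1X.add (InQ.const (by linarith))
      · rintro x ⟨h1, h2⟩; linarith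

end Strip

end Part1

section Part2

open Polynomial

namespace Strip

theorem IsSumSq_map {R S : Type*} [CommRing R] [CommRing S] (φ : R →+* S) {a : R} (h : IsSumSq a) :
    IsSumSq (φ a) := by
  induction h with
  | zero => simp
  | sq_add a h ih => rw [map_add, map_mul]; exact (IsSumSq.mul_self _).add ih

theorem inQ_of_real (p : ℝ[X]) (hp : ∀ y, 0 ≤ p.eval y) : InQ (p.map C) :=
  InQ.of_sumSq (IsSumSq_map (mapRingHom C) (univ_real p hp))

theorem evalEval_eq_sum {p : ℝ[X][X]} {n : ℕ} (hn : p.natDegree < n) (x y : ℝ) :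
    p.evalEval x y = ∑ i ∈ Finset.range n, (p.coeff i).eval x * y ^ i := by
  rw [← map_evalRingHom_eval, eval_eq_sum_range' (lt_of_le_of_lt natDegree_map_le hn)]
  simp [coeff_map]

/-- the weight `(1+y^2)^d` -/
noncomputable def W (d : ℕ) : ℝ[X][X] := (1 + X ^ 2) ^ d

theorem W_eval (d : ℕ) (x y : ℝ) : (W d).evalEval x y = (1 + y ^ 2) ^ d := by
  simp [W, evalEval]

theorem W_natDegree (d : ℕ) : (W d).natDegree ≤ 2 * d := by
  unfold W
  refine natDegree_pow_le.trans ?_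
  rw [mul_comm]
  gcongr
  compute_degree

theorem W_sub (d a : ℕ) (h : a ≤ d) : InQ (W d - X ^ (2 * a)) := by
  have := inQ_of_real ((1 + X ^ 2) ^ d - X ^ (2 * a)) (by
    intro y
    simp only [eval_sub, eval_pow, eval_add, eval_one, eval_X]
    rw [sub_nonneg, pow_mul]
    calc (y ^ 2) ^ a ≤ (1 + y ^ 2) ^ a := by gcongr; linarith
      _ ≤ _ := pow_le_pow_right₀ (by nlinarith) h)
  simpa [W] using this

theorem small_term (d i : ℕ) (hi : i ≤ 2 * d) (r : ℝ[X]) (ε : ℝ)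
    (h : ∀ x ∈ Set.Icc (0:ℝ) 1, |r.eval x| ≤ ε) : InQ (C r * X ^ i + C (C ε) * W d) := by
  have hε : 0 ≤ ε := (abs_nonneg _).trans (h 0 (by simp))
  have h1 : InQ (C (r + C ε)) := univ_unit _ fun x hx => by
    have := abs_le.1 (h x hx); simp only [eval_add, eval_C]; linarith
  have h2 : InQ (C (C ε - r)) := univ_unit _ fun x hx => by
    have := abs_le.1 (h x hx); simp only [eval_sub, eval_C]; linarith
  have hq : InQ (C (C (1/4))) := InQ.const (by norm_num)
  have hhalf : InQ (C (C (1/2))) := InQ.const (by norm_num)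
  obtain ⟨k, rfl | rfl⟩ := Nat.even_or_odd' i
  · have : C r * X ^ (2 * k) + C (C ε) * W d = C (r + C ε) * (X ^ k) ^ 2 +
        C (C ε) * (W d - X ^ (2 * k)) := by
      rw [C_add]; ring
    rw [this]
    exact (h1.mul (InQ.sq _)).add ((InQ.const hε).mul (W_sub _ _ (by omega)))
  · have e4 : (C (C (1/4)) : ℝ[X][X]) * 4 = 1 := by
      rw [show (4 : ℝ[X][X]) = C (C 4) by simp only [map_ofNat], ← C_mul, ← C_mul]; norm_num
    have e2 : (C (C (1/2)) : ℝ[X][X]) * 2 = 1 := by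
      rw [show (2 : ℝ[X][X]) = C (C 2) by simp only [map_ofNat], ← C_mul, ← C_mul]; norm_num
    have : C r * X ^ (2 * k + 1) + C (C ε) * W d =
        C (C (1/4)) * (C (r + C ε) * (X ^ k + X ^ (k + 1)) ^ 2) +
        C (C (1/4)) * (C (C ε - r) * (X ^ k - X ^ (k + 1)) ^ 2) +
        C (C ε) * (C (C (1/2)) * ((W d - X ^ (2 * k)) + (W d - X ^ (2 * (k + 1))))) := by
      rw [C_add, C_sub]
      generalize C r = R, C (C ε) = E, W d = V at *
      generalize (C (C (1/4)) : ℝ[X][X]) = q4, (C (C (1/2)) : ℝ[X][X]) = q2 at *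
      have e5 : q2 = 2 * q4 := by linear_combination (2 * q4) * e2 - q2 * e4
      subst e5
      linear_combination (-(R * X ^ (2 * k + 1) + E * V)) * e4
    rw [this]
    refine ((hq.mul (h1.mul (InQ.sq _))).add (hq.mul (h2.mul (InQ.sq _)))).add
      ((InQ.const hε).mul (hhalf.mul ((W_sub _ _ (by omega)).add (W_sub _ _ (by omega)))))

theorem small_poly (d : ℕ) (r : ℝ[X][X]) (hr : r.natDegree ≤ 2 * d) (ε : ℝ)
    (h : ∀ i, ∀ x ∈ Set.Icc (0:ℝ) 1, |(r.coeff i).eval x| ≤ ε) :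
    InQ (r + C (C ((2 * d + 1 : ℕ) * ε)) * W d) := by
  have : r + C (C ((2 * d + 1 : ℕ) * ε)) * W d =
      ∑ i ∈ Finset.range (2 * d + 1), (C (r.coeff i) * X ^ i + C (C ε) * W d) := by
    rw [Finset.sum_add_distrib, ← as_sum_range_C_mul_X_pow' r (n := 2 * d + 1) (by omega)]
    simp only [Finset.sum_const, Finset.card_range, nsmul_eq_mul, C_mul, map_natCast, mul_assoc]
  rw [this]
  refine InQ.sum _ _ fun i hi => small_term d i ?_ _ _ (h i)
  have := Finset.mem_range.1 hi; omega

theorem bern_inQ (n k : ℕ) : InQ (C (bernsteinPolynomial ℝ n k)) := by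
  unfold bernsteinPolynomial
  rw [C_mul, C_mul, C_pow, C_pow]
  refine (InQ.mul ?_ (InQ.CX.pow _)).mul (InQ.C1X.pow _)
  have := InQ.const (c := (n.choose k : ℝ)) (by positivity)
  simpa using this

theorem bern_approx (p : ℝ[X]) (ε : ℝ) (hε : 0 < ε) : ∀ᶠ n : ℕ in Filter.atTop,
    ∀ x ∈ Set.Icc (0:ℝ) 1, |(p - ∑ k : Fin (n + 1), bernsteinPolynomial ℝ n k *
      C (p.eval ((k : ℝ) / n))).eval x| ≤ ε := by
  have h := bernsteinApproximation_uniform (p.toContinuousMapOn unitInterval)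
  rw [Metric.tendsto_atTop] at h
  obtain ⟨N, hN⟩ := h ε hε
  filter_upwards [Filter.eventually_ge_atTop N] with n hn x hx
  have h1 := hN n hn
  have h2 := ContinuousMap.dist_apply_le_dist (f := bernsteinApproximation n (p.toContinuousMapOn unitInterval))
    (g := p.toContinuousMapOn unitInterval) ⟨x, hx⟩
  have h3 := h2.trans h1.le
  rw [dist_comm, Real.dist_eq, bernsteinApproximation.apply] at h3
  simpa [eval_finsetSum, bernstein, bernstein.z] using h3

theorem strict_case (d : ℕ) (g : ℝ[X][X]) (hdeg : g.natDegree ≤ 2 * d) (c : ℝ) (hc : 0 < c)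
    (h : ∀ x ∈ Set.Icc (0:ℝ) 1, ∀ y, c * (1 + y ^ 2) ^ d ≤ g.evalEval x y) : InQ g := by
  set g' := g - C (C c) * W d with hg'
  have hdeg' : g'.natDegree ≤ 2 * d := by
    refine (natDegree_sub_le _ _).trans (max_le hdeg ?_)
    exact (natDegree_C_mul_le _ _).trans (W_natDegree d)
  have hpos : ∀ x ∈ Set.Icc (0:ℝ) 1, ∀ y, 0 ≤ g'.evalEval x y := by
    intro x hx y
    rw [hg', evalEval_sub, evalEval_mul, W_eval, evalEval_CC, sub_nonneg]
    exact h x hx y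
  set ε := c / (2 * d + 1 : ℕ) with hε
  have hε0 : 0 < ε := by positivity
  have hev : ∀ᶠ n : ℕ in Filter.atTop, ∀ i ∈ Finset.range (2 * d + 1),
      ∀ x ∈ Set.Icc (0:ℝ) 1, |(g'.coeff i - ∑ k : Fin (n + 1), bernsteinPolynomial ℝ n k *
      C ((g'.coeff i).eval ((k : ℝ) / n))).eval x| ≤ ε := by
    rw [Filter.eventually_all_finset]
    intro i _
    exact bern_approx _ ε hε0
  obtain ⟨n, hn⟩ := hev.exists
  set B : ℝ[X][X] := ∑ k : Fin (n + 1), C (bernsteinPolynomial ℝ n k) *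
    (g'.map (evalRingHom ((k : ℝ) / n))).map C with hB
  have hBQ : InQ B := by
    refine InQ.sum _ _ fun k _ => (bern_inQ _ _).mul (inQ_of_real _ ?_)
    intro y
    rw [map_evalRingHom_eval]
    exact hpos _ (bernstein.z k).2 y
  have hcoeff : ∀ i, (g' - B).coeff i = g'.coeff i - ∑ k : Fin (n + 1), bernsteinPolynomial ℝ n k *
      C ((g'.coeff i).eval ((k : ℝ) / n)) := by
    intro i
    simp [hB, finsetSum_coeff, coeff_map]
  have hBdeg : B.natDegree ≤ 2 * d := by
    refine natDegree_sum_le_of_forall_le _ _ fun k _ => ?_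
    exact (natDegree_C_mul_le _ _).trans (natDegree_map_le.trans (natDegree_map_le.trans hdeg'))
  have hr := small_poly d (g' - B) ((natDegree_sub_le _ _).trans (max_le hdeg' hBdeg)) ε (by
    intro i x hx
    rw [hcoeff]
    by_cases hi : i < 2 * d + 1
    · exact hn i (Finset.mem_range.2 hi) x hx
    · rw [coeff_eq_zero_of_natDegree_lt (by omega)]
      simpa using hε0.le)
  have e : g = B + (g' - B + C (C ((2 * d + 1 : ℕ) * ε)) * W d) := by
    have : ((2 * d + 1 : ℕ) : ℝ) * ε = c := by rw [hε]; field_simp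
    rw [this, hg']; ring
  rw [e]
  exact hBQ.add hr

end Strip

end Part2

section Part3

open Polynomial

namespace Strip

theorem pow_le_weight (d i : ℕ) (hi : i ≤ 2 * d) (y : ℝ) : |y| ^ i ≤ (1 + y ^ 2) ^ d := by
  rcases le_total |y| 1 with h | h
  · exact (pow_le_one₀ (abs_nonneg y) h).trans (one_le_pow₀ (by nlinarith))
  · calc |y| ^ i ≤ |y| ^ (2 * d) := pow_le_pow_right₀ h hi
      _ = (y ^ 2) ^ d := by rw [pow_mul, sq_abs]
      _ ≤ _ := by gcongr; linarith

theorem poly_bound (p : ℝ[X]) : ∃ A : ℝ, 0 < A ∧ ∀ x ∈ Set.Icc (0:ℝ) 1, |p.eval x| ≤ A := by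
  obtain ⟨A, hA⟩ := (isCompact_Icc (a := (0:ℝ)) (b := 1)).exists_bound_of_continuousOn
    (p.continuous.continuousOn (s := Set.Icc (0:ℝ) 1))
  refine ⟨|A| + 1, by positivity, fun x hx => ?_⟩
  have := hA x hx
  rw [Real.norm_eq_abs] at this
  linarith [le_abs_self A]

theorem bound (d : ℕ) (r : ℝ[X][X]) (hr : r.natDegree ≤ 2 * d) : ∃ A : ℝ, 0 < A ∧
    ∀ x ∈ Set.Icc (0:ℝ) 1, ∀ y, |r.evalEval x y| ≤ A * (1 + y ^ 2) ^ d := by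
  choose A hA0 hA using fun i => poly_bound (r.coeff i)
  refine ⟨∑ i ∈ Finset.range (2 * d + 1), A i, Finset.sum_pos (fun i _ => hA0 i) (by simp), ?_⟩
  intro x hx y
  rw [evalEval_eq_sum (show r.natDegree < 2 * d + 1 by omega), Finset.sum_mul]
  refine (Finset.abs_sum_le_sum_abs _ _).trans (Finset.sum_le_sum fun i hi => ?_)
  rw [abs_mul, abs_pow]
  have := Finset.mem_range.1 hi
  exact mul_le_mul (hA i x hx) (pow_le_weight d i (by omega) y) (by positivity) (hA0 i).le

theorem bump (x₀ : ℝ) (hx₀ : x₀ ∈ Set.Icc (0:ℝ) 1) (δ ε : ℝ) (hδ : 0 < δ) (hε : 0 < ε) (K : ℕ) :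
    ∃ ψ : ℝ[X], (∀ x ∈ Set.Icc (0:ℝ) 1, 0 ≤ ψ.eval x ∧ ψ.eval x ≤ 1) ∧
      (∀ x ∈ Set.Icc (0:ℝ) 1, δ ≤ |x - x₀| → ψ.eval x ≤ ε) ∧ (X - C x₀) ^ (2 * K) ∣ 1 - ψ := by
  have hu : ∀ x ∈ Set.Icc (0:ℝ) 1, 0 ≤ 1 - (x - x₀) ^ 2 := by
    rintro x ⟨h1, h2⟩
    have : |x - x₀| ≤ 1 := abs_le.2 ⟨by linarith [hx₀.2], by linarith [hx₀.1]⟩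
    have := sq_le_one_iff_abs_le_one (x - x₀) |>.2 this
    linarith
  obtain ⟨δ', hδ', hδ1, hδ2⟩ : ∃ δ', 0 < δ' ∧ δ' ≤ δ ∧ δ' < 1 :=
    ⟨min δ (1/2), by positivity, min_le_left _ _, (min_le_right _ _).trans_lt (by norm_num)⟩
  have hlim := tendsto_pow_atTop_nhds_zero_of_lt_one (r := 1 - δ' ^ 2) (by nlinarith) (by nlinarith)
  have hev := (hlim.const_mul (K : ℝ)).eventually (gt_mem_nhds (show (K : ℝ) * 0 < ε by simpa))
  obtain ⟨m, hm⟩ := hev.exists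
  refine ⟨1 - (1 - (1 - (X - C x₀) ^ 2) ^ m) ^ K, ?_, ?_, ?_⟩
  · intro x hx
    have h0 := hu x hx
    have h1 : 1 - (x - x₀) ^ 2 ≤ 1 := by nlinarith [sq_nonneg (x - x₀)]
    have h2 := pow_le_one₀ (n := m) h0 h1
    have h3 : 0 ≤ (1 - (x - x₀) ^ 2) ^ m := pow_nonneg h0 _
    have h4 := pow_le_one₀ (n := K) (a := 1 - (1 - (x - x₀) ^ 2) ^ m) (by linarith) (by linarith)
    have h5 : 0 ≤ (1 - (1 - (x - x₀) ^ 2) ^ m) ^ K := pow_nonneg (by linarith) _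
    simp only [eval_sub, eval_one, eval_pow, eval_X, eval_C]
    constructor <;> linarith
  · intro x hx hxd
    have h0 := hu x hx
    have h1 : 1 - (x - x₀) ^ 2 ≤ 1 := by nlinarith [sq_nonneg (x - x₀)]
    have h2 := pow_le_one₀ (n := m) h0 h1
    have h3 : 0 ≤ (1 - (x - x₀) ^ 2) ^ m := pow_nonneg h0 _
    have h4 := one_add_mul_le_pow (a := -(1 - (x - x₀) ^ 2) ^ m) (by linarith) K
    have h5 : (1 - (x - x₀) ^ 2) ^ m ≤ (1 - δ' ^ 2) ^ m := by
      apply pow_le_pow_left₀ h0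
      have : δ' ^ 2 ≤ |x - x₀| ^ 2 := by gcongr; linarith
      rw [sq_abs] at this; linarith
    simp only [eval_sub, eval_one, eval_pow, eval_X, eval_C]
    have h6 := mul_le_mul_of_nonneg_left h5 (show (0:ℝ) ≤ K by positivity)
    rw [← sub_eq_add_neg] at h4
    linarith
  · rw [sub_sub_cancel, pow_mul]
    refine pow_dvd_pow_of_dvd ?_ K
    have := sub_dvd_pow_sub_pow (1 : ℝ[X]) (1 - (X - C x₀) ^ 2) m
    simpa using this

/-- The local decomposition property. -/
def LocalProp : Prop := ∀ (d : ℕ) (F : ℝ[X][X]) (_ : F.natDegree ≤ 2 * d) (P : ℝ[X]) (_ : P ≠ 0)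
  (_ : ∀ x ∈ Set.Icc (0:ℝ) 1, ∀ y, (P.eval x) ^ 2 * (1 + y ^ 2) ^ d ≤ F.evalEval x y) (x₀ : ℝ)
  (_ : x₀ ∈ Set.Icc (0:ℝ) 1) (M : ℕ),
  ∃ S : ℝ[X][X], InQ S ∧ S.natDegree ≤ 2 * d ∧ C ((X - C x₀) ^ M) ∣ F - S

theorem global (hloc : LocalProp) (d : ℕ) : ∀ (n : ℕ) (P : ℝ[X]), P ≠ 0 → P.natDegree = n →
    ∀ (g : ℝ[X][X]) (c : ℝ), 0 < c → g.natDegree ≤ 2 * d →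
    (∀ x ∈ Set.Icc (0:ℝ) 1, ∀ y, c * (P.eval x) ^ 2 * (1 + y ^ 2) ^ d ≤ g.evalEval x y) →
    InQ g := by
  intro n
  induction n using Nat.strong_induction_on with
  | _ n ih =>
  intro P hP hPn g c hc hg h
  by_cases hroot : ∃ x₀ ∈ Set.Icc (0:ℝ) 1, P.eval x₀ = 0
  swap
  · push Not at hroot
    obtain ⟨z, hz, hmin⟩ := (isCompact_Icc (a := (0:ℝ)) (b := 1)).exists_isMinOn ⟨0, by simp⟩
      ((P ^ 2).continuous.continuousOn (s := Set.Icc (0:ℝ) 1))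
    have hz' := hroot z hz
    refine strict_case d g hg (c * (P.eval z) ^ 2) (by positivity) fun x hx y => ?_
    refine le_trans ?_ (h x hx y)
    have : (P ^ 2).eval z ≤ (P ^ 2).eval x := hmin hx
    rw [eval_pow, eval_pow] at this
    gcongr
  obtain ⟨x₀, hx₀, hr⟩ := hroot
  set N := P.rootMultiplicity x₀ with hN
  have hNpos : 0 < N := (rootMultiplicity_pos hP).2 hr
  obtain ⟨P₁, hP₁, hnd⟩ := exists_eq_pow_rootMultiplicity_mul_and_not_dvd P hP x₀
  rw [← hN] at hP₁
  have hP₁r : P₁.eval x₀ ≠ 0 := fun h0 => hnd (dvd_iff_isRoot.2 h0)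
  have hP₁0 : P₁ ≠ 0 := by rintro rfl; simp at hP₁r
  have hPdeg : P₁.natDegree < n := by
    rw [← hPn, hP₁, natDegree_mul (pow_ne_zero _ (X_sub_C_ne_zero _)) hP₁0, natDegree_pow,
      natDegree_X_sub_C]
    omega
  set w : ℝ[X] := X - C x₀ with hw
  have hw0 : w ≠ 0 := X_sub_C_ne_zero _
  set F := g - C (C (c / 2) * P ^ 2) * W d with hF
  have hFdeg : F.natDegree ≤ 2 * d := (natDegree_sub_le _ _).trans
    (max_le hg ((natDegree_C_mul_le _ _).trans (W_natDegree d)))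
  have hFev : ∀ x y, F.evalEval x y = g.evalEval x y - c / 2 * (P.eval x) ^ 2 * (1 + y ^ 2) ^ d := by
    intro x y
    rw [hF, evalEval_sub, evalEval_mul, evalEval_C, W_eval, eval_mul, eval_C, eval_pow]
  obtain ⟨S, hSQ, hSdeg, hSdvd⟩ := hloc d F hFdeg (C (Real.sqrt (c / 2)) * P)
    (mul_ne_zero (by simp; positivity) hP) (by
      intro x hx y
      rw [eval_mul, eval_C, mul_pow, Real.sq_sqrt (by positivity), hFev]
      have h1 := h x hx y
      linarith) x₀ hx₀ (2 * N + 1)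
  have hcop : IsCoprime P₁ (w ^ (2 * N + 1)) := by
    apply IsCoprime.pow_right
    exact (isCoprime_comm.1 ((irreducible_X_sub_C x₀).coprime_iff_not_dvd.2 hnd))
  obtain ⟨a, b, hab⟩ := hcop
  set S' := C (P₁ ^ 2) * (C (a ^ 2) * S) with hS'
  have hS''deg : (C (a ^ 2) * S).natDegree ≤ 2 * d := (natDegree_C_mul_le _ _).trans hSdeg
  have hS'deg : S'.natDegree ≤ 2 * d := (natDegree_C_mul_le _ _).trans hS''deg
  have hS'Q : InQ S' := by
    rw [hS', C_pow, C_pow]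
    exact (InQ.sq _).mul ((InQ.sq _).mul hSQ)
  obtain ⟨r, hr'⟩ : C (w ^ (2 * N + 1)) ∣ F - S' := by
    have : F - S' = (F - S) + C (w ^ (2 * N + 1)) * (C (b * (1 + a * P₁)) * S) := by
      have e : P₁ ^ 2 * a ^ 2 = 1 - w ^ (2 * N + 1) * (b * (1 + a * P₁)) := by
        linear_combination (1 + a * P₁) * hab
      have e' := congrArg (C : ℝ[X] → ℝ[X][X]) e
      rw [C_mul, C_sub, C_mul, C_1] at e'
      rw [hS']
      linear_combination (-S) * e'
    rw [this]
    exact dvd_add hSdvd (dvd_mul_right _ _)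
  have hrdeg : r.natDegree ≤ 2 * d := by
    rw [← natDegree_C_mul (p := r) (pow_ne_zero (2 * N + 1) hw0), ← hr']
    exact (natDegree_sub_le _ _).trans (max_le hFdeg hS'deg)
  obtain ⟨A₁, hA₁, hA₁b⟩ := bound d r hrdeg
  obtain ⟨A₂, hA₂, hA₂b⟩ := bound d _ hS''deg
  obtain ⟨δ, hδ, hδb⟩ : ∃ δ : ℝ, 0 < δ ∧ ∀ x, |x - x₀| < δ → A₁ * |x - x₀| ≤ c / 4 * (P₁.eval x) ^ 2 := by
    have hcont : ContinuousAt (fun x => c / 4 * (P₁.eval x) ^ 2 - A₁ * |x - x₀|) x₀ := by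
      have := P₁.continuous
      fun_prop
    have hpos : 0 < c / 4 * (P₁.eval x₀) ^ 2 - A₁ * |x₀ - x₀| := by
      simp only [sub_self, abs_zero, mul_zero, sub_zero]; positivity
    obtain ⟨δ, hδ, hb⟩ := Metric.eventually_nhds_iff.1 (hcont.eventually (lt_mem_nhds hpos))
    refine ⟨δ, hδ, fun x hx => ?_⟩
    have := hb (y := x) (by rwa [Real.dist_eq])
    linarith
  obtain ⟨ε, hε, hεb⟩ : ∃ ε : ℝ, 0 < ε ∧ ε ^ 2 * A₂ ≤ c / 2 * δ ^ (2 * N) := by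
    refine ⟨Real.sqrt (c / 2 * δ ^ (2 * N) / A₂), by positivity, ?_⟩
    rw [Real.sq_sqrt (by positivity)]
    apply le_of_eq
    field_simp
  obtain ⟨ψ, hψ1, hψ2, hψ3⟩ := bump x₀ hx₀ δ ε hδ hε N
  set G := g - C (ψ ^ 2) * S' with hG
  have hwx : ∀ x, w.eval x = x - x₀ := by intro x; simp [hw]
  have hPx : ∀ x, (P.eval x) ^ 2 = (x - x₀) ^ (2 * N) * (P₁.eval x) ^ 2 := by
    intro x; rw [hP₁, eval_mul, eval_pow, hwx]; ring
  have hGpos : ∀ x ∈ Set.Icc (0:ℝ) 1, ∀ y,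
      (x - x₀) ^ (2 * N) * (c / 4 * (P₁.eval x) ^ 2 * (1 + y ^ 2) ^ d) ≤ G.evalEval x y := by
    intro x hx y
    have hW : (0:ℝ) < (1 + y ^ 2) ^ d := by positivity
    have hS0 := hS'Q.nonneg hx y
    have hpow : 0 ≤ (x - x₀) ^ (2 * N) := by rw [pow_mul]; positivity
    obtain ⟨hp0, hp1⟩ := hψ1 x hx
    have hGev : G.evalEval x y = g.evalEval x y - (ψ.eval x) ^ 2 * S'.evalEval x y := by
      rw [hG, evalEval_sub, evalEval_mul, evalEval_C, eval_pow]
    rw [hGev]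
    rcases lt_or_ge |x - x₀| δ with hlt | hge
    · have e1 : g.evalEval x y - S'.evalEval x y = (x - x₀) ^ (2 * N) *
          (c / 2 * (P₁.eval x) ^ 2 * (1 + y ^ 2) ^ d + (x - x₀) * r.evalEval x y) := by
        have := congrArg (evalEval x y) hr'
        have h2 : evalEval x y (C (w ^ (2 * N + 1)) * r) = (x - x₀) ^ (2 * N + 1) * r.evalEval x y := by
          rw [evalEval_mul, evalEval_C, eval_pow, hwx]
        rw [evalEval_sub, hFev, h2, hPx] at this
        linear_combination this
      have e2 : |(x - x₀) * r.evalEval x y| ≤ c / 4 * (P₁.eval x) ^ 2 * (1 + y ^ 2) ^ d := by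
        rw [abs_mul]
        calc |x - x₀| * |r.evalEval x y| ≤ |x - x₀| * (A₁ * (1 + y ^ 2) ^ d) := by
              gcongr; exact hA₁b x hx y
          _ = (A₁ * |x - x₀|) * (1 + y ^ 2) ^ d := by ring
          _ ≤ _ := mul_le_mul_of_nonneg_right (hδb x hlt) hW.le
      have e3 := (abs_le.1 e2).1
      have e4 : (ψ.eval x) ^ 2 * S'.evalEval x y ≤ S'.evalEval x y :=
        mul_le_of_le_one_left hS0 (pow_le_one₀ hp0 hp1)
      calc _ ≤ (x - x₀) ^ (2 * N) *
          (c / 2 * (P₁.eval x) ^ 2 * (1 + y ^ 2) ^ d + (x - x₀) * r.evalEval x y) := by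
            gcongr; linarith
        _ = g.evalEval x y - S'.evalEval x y := e1.symm
        _ ≤ _ := by linarith
    · have h1 := h x hx y
      rw [hPx] at h1
      have e1 : S'.evalEval x y ≤ (P₁.eval x) ^ 2 * (A₂ * (1 + y ^ 2) ^ d) := by
        rw [hS', evalEval_mul, evalEval_C, eval_pow]
        gcongr
        exact (le_abs_self _).trans (hA₂b x hx y)
      have e2 : (ψ.eval x) ^ 2 ≤ ε ^ 2 := by gcongr; exact hψ2 x hx hge
      have e3 : δ ^ (2 * N) ≤ (x - x₀) ^ (2 * N) := by
        rw [← Even.pow_abs (n := 2 * N) ⟨N, by ring⟩ (x - x₀)]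
        gcongr
      have e4 : ε ^ 2 * A₂ ≤ c / 2 * (x - x₀) ^ (2 * N) := hεb.trans (by gcongr)
      have e5 : (ψ.eval x) ^ 2 * S'.evalEval x y ≤ c / 2 * (x - x₀) ^ (2 * N) * ((P₁.eval x) ^ 2 * (1 + y ^ 2) ^ d) := by
        calc _ ≤ ε ^ 2 * ((P₁.eval x) ^ 2 * (A₂ * (1 + y ^ 2) ^ d)) := by gcongr
          _ = (ε ^ 2 * A₂) * ((P₁.eval x) ^ 2 * (1 + y ^ 2) ^ d) := by ring
          _ ≤ _ := by gcongr
      have e6 : 0 ≤ c * ((x - x₀) ^ (2 * N) * ((P₁.eval x) ^ 2 * (1 + y ^ 2) ^ d)) := by positivity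
      nlinarith
  obtain ⟨G₁, hG₁⟩ : C (w ^ (2 * N)) ∣ G := by
    have e : G = C (w ^ (2 * N)) * (C (C (c / 2) * P₁ ^ 2) * W d + C w * r)
        + C (1 - ψ) * (C (1 + ψ) * S') := by
      have h1 : g = F + C (C (c / 2) * P ^ 2) * W d := by rw [hF]; ring
      have h2 : F = S' + C (w ^ (2 * N + 1)) * r := by rw [← hr']; ring
      have h3 : P ^ 2 = w ^ (2 * N) * P₁ ^ 2 := by rw [hP₁]; ring
      rw [hG, h1, h2, h3]
      simp only [C_mul, C_pow, C_add, C_sub, C_1]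
      ring
    rw [e]
    exact dvd_add (dvd_mul_right _ _) (Dvd.dvd.mul_right (_root_.map_dvd C hψ3) _)
  have hGdeg : G.natDegree ≤ 2 * d := (natDegree_sub_le _ _).trans
    (max_le hg ((natDegree_C_mul_le _ _).trans hS'deg))
  have hG₁deg : G₁.natDegree ≤ 2 * d := by
    rwa [hG₁, natDegree_C_mul (pow_ne_zero _ hw0)] at hGdeg
  have hG₁Q : InQ G₁ := by
    refine ih P₁.natDegree hPdeg P₁ hP₁0 rfl G₁ (c / 4) (by positivity) hG₁deg ?_
    intro x hx y
    have key := nonneg_of_dense (S := Set.Icc (0:ℝ) 1)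
      (by rw [interior_Icc, closure_Ioo (by norm_num)]) (w := w)
      (r := eval (C y) (G₁ - C (C (c / 4) * P₁ ^ 2) * W d)) hw0 ?_ x hx
    · change 0 ≤ evalEval x y _ at key
      rw [evalEval_sub, evalEval_mul, evalEval_C, W_eval, eval_mul, eval_C, eval_pow] at key
      linarith
    · intro x hx hxw
      change 0 ≤ evalEval x y _
      rw [evalEval_sub, evalEval_mul, evalEval_C, W_eval, eval_mul, eval_C, eval_pow]
      have h1 := hGpos x hx y
      rw [hG₁, evalEval_mul, evalEval_C, eval_pow, hwx] at h1
      rw [hwx] at hxw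
      have h2 : 0 < (x - x₀) ^ (2 * N) := by rw [pow_mul]; positivity
      have := le_of_mul_le_mul_left h1 h2
      linarith
  have e : g = C ψ ^ 2 * S' + (C (w ^ N)) ^ 2 * G₁ := by
    have : g = G + C (ψ ^ 2) * S' := by rw [hG]; ring
    rw [this, hG₁, ← C_pow, ← C_pow, ← pow_mul, mul_comm N 2]; ring
  rw [e]
  exact ((InQ.sq _).mul hS'Q).add ((InQ.sq _).mul hG₁Q)

end Strip

end Part3

section Part4

open Polynomial

namespace Strip

theorem tail_bound (n : ℕ) (hn : 1 ≤ n) (f : ℝ[X][X]) (hf : f.natDegree = n) :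
    ∃ s : ℝ, 0 < s ∧ ∀ x ∈ Set.Icc (0:ℝ) 1, |s * f.leadingCoeff.eval x| ≤ 1 ∧
      ∀ y : ℝ, 1 ≤ |y| → |s * f.evalEval x y - s * f.leadingCoeff.eval x * y ^ n| ≤ 1 / 2 * |y| ^ (n - 1) := by
  choose A hA0 hA using fun i => poly_bound (f.coeff i)
  set B := ∑ i ∈ Finset.range (n + 1), A i with hB
  have hBpos : 0 < B := Finset.sum_pos (fun i _ => hA0 i) (by simp)
  have hAn : A n ≤ B := Finset.single_le_sum (fun i _ => (hA0 i).le) (by simp)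
  have hAB : ∑ i ∈ Finset.range n, A i ≤ B := by
    rw [hB, Finset.sum_range_succ]; linarith [(hA0 n)]
  refine ⟨1 / (2 * B), by positivity, fun x hx => ⟨?_, fun y hy => ?_⟩⟩
  · rw [abs_mul, abs_of_pos (by positivity : 0 < 1 / (2 * B)), leadingCoeff, hf]
    have := hA n x hx
    rw [div_mul_eq_mul_div, div_le_one (by positivity)]
    linarith
  · rw [evalEval_eq_sum (show f.natDegree < n + 1 by omega), Finset.sum_range_succ, leadingCoeff, hf,
      mul_assoc, ← mul_sub, add_sub_cancel_right, abs_mul, abs_of_pos (by positivity : 0 < 1 / (2 * B))]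
    have : |∑ i ∈ Finset.range n, (f.coeff i).eval x * y ^ i| ≤ B * |y| ^ (n - 1) := by
      refine (Finset.abs_sum_le_sum_abs _ _).trans ?_
      refine le_trans ?_ (mul_le_mul_of_nonneg_right hAB (by positivity))
      rw [Finset.sum_mul]
      refine Finset.sum_le_sum fun i hi => ?_
      rw [abs_mul, abs_pow]
      have := Finset.mem_range.1 hi
      exact mul_le_mul (hA i x hx) (pow_le_pow_right₀ hy (by omega)) (by positivity) (hA0 i).le
    calc _ ≤ 1 / (2 * B) * (B * |y| ^ (n - 1)) := by gcongr
      _ = _ := by field_simp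

theorem lead_sign (n : ℕ) (hn : 1 ≤ n) (q : ℝ → ℝ) (a : ℝ) (ha : a ≠ 0) (ha1 : |a| ≤ 1)
    (htail : ∀ y : ℝ, 1 ≤ |y| → |q y - a * y ^ n| ≤ 1 / 2 * |y| ^ (n - 1))
    (hq : ∀ y, 0 ≤ q y) : Even n ∧ 0 < a := by
  have hR : 1 ≤ |a|⁻¹ := (one_le_inv₀ (abs_pos.2 ha)).2 ha1
  have hpos : 0 < |a| := abs_pos.2 ha
  have key : ∀ y, |y| = |a|⁻¹ → 0 < a * y ^ n := by
    intro y hy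
    have h1 := htail y (by rw [hy]; exact hR)
    have h2 : |a * y ^ n| = |y| ^ (n - 1) := by
      obtain ⟨m, rfl⟩ : ∃ m, n = m + 1 := ⟨n - 1, by omega⟩
      rw [abs_mul, abs_pow, hy, pow_succ, Nat.add_sub_cancel]
      field_simp
    rw [← h2] at h1
    have h3 : 0 < |a * y ^ n| := by
      rw [h2, hy]; positivity
    by_contra hle
    push Not at hle
    rw [abs_of_nonpos hle] at h1 h3
    have := (abs_le.1 h1).2
    linarith [hq y]
  have k1 := key |a|⁻¹ (by rw [abs_of_pos (by positivity)])
  have hapos : 0 < a := pos_of_mul_pos_left k1 (by positivity)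
  refine ⟨?_, hapos⟩
  by_contra hodd
  rw [Nat.not_even_iff_odd] at hodd
  have k2 := key (-|a|⁻¹) (by rw [abs_neg, abs_of_pos (by positivity)])
  rw [hodd.neg_pow] at k2
  linarith

theorem slack_point (d k : ℕ) (hd : 1 ≤ d) (q u v : ℝ[X]) (a D : ℝ) (ha : 0 < a) (ha1 : a ≤ 1)
    (hD : D ≠ 0) (hD1 : |D| ≤ 1)
    (htail : ∀ y : ℝ, 1 ≤ |y| → |q.eval y - a * y ^ (2 * d)| ≤ 1 / 2 * |y| ^ (2 * d - 1))
    (hu : ∀ y, |u.eval y| ≤ (1 + y ^ 2) ^ k) (hrel : u * q + v * derivative q = C D)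
    (hq : ∀ y, 0 ≤ q.eval y) (y : ℝ) :
    D ^ 2 * (a ^ 2 / 2) ^ (k + 1 + d) * (1 + y ^ 2) ^ d ≤ q.eval y := by
  set R := a⁻¹ with hR
  have hR1 : 1 ≤ R := (one_le_inv₀ ha).2 ha1
  set b := a ^ 2 / 2 with hb
  have hb0 : 0 < b := by positivity
  have hb1 : b ≤ 1 := by rw [hb]; nlinarith
  have hba : b ≤ a / 2 := by rw [hb]; nlinarith
  have hD2 : D ^ 2 ≤ |D| := by rw [← sq_abs]; nlinarith [abs_nonneg D]
  have hD21 : D ^ 2 ≤ 1 := hD2.trans hD1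
  have hlarge : ∀ y, R ≤ |y| → a / 2 * y ^ (2 * d) ≤ q.eval y := by
    intro y hy
    have h1 := htail y (hR1.trans hy)
    have h2 : |y| ^ (2 * d - 1) ≤ a * y ^ (2 * d) := by
      obtain ⟨m, hm⟩ : ∃ m, 2 * d = m + 1 := ⟨2 * d - 1, by omega⟩
      have h3 : y ^ (2 * d) = |y| ^ (2 * d) := by rw [Even.pow_abs ⟨d, by ring⟩]
      rw [h3, hm, Nat.add_sub_cancel, pow_succ]
      have : 1 ≤ a * |y| := by
        have := mul_le_mul_of_nonneg_left hy ha.le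
        rwa [hR, mul_inv_cancel₀ ha.ne'] at this
      nlinarith [pow_nonneg (abs_nonneg y) m]
    have := (abs_le.1 h1).1
    linarith
  have hRb : (1 + R ^ 2) * b ≤ 1 := by
    rw [hb, hR]; field_simp; nlinarith
  have hsmallw : ∀ (j : ℕ) (y : ℝ), |y| ≤ R → (1 + y ^ 2) ^ j * b ^ j ≤ 1 := by
    intro j y hy
    rw [← mul_pow]
    apply pow_le_one₀ (by positivity)
    refine le_trans ?_ hRb
    have : y ^ 2 ≤ R ^ 2 := sq_le_sq' (by linarith [(abs_le.1 hy).1]) (abs_le.1 hy).2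
    gcongr
  rcases le_total R |y| with hy | hy
  · have h1 := hlarge y hy
    have hy1 : 1 ≤ y ^ 2 := by
      have := hR1.trans hy
      rw [← sq_abs]; nlinarith
    have h2 : b ^ d * (1 + y ^ 2) ^ d ≤ y ^ (2 * d) := by
      rw [← mul_pow, pow_mul]
      apply pow_le_pow_left₀ (by positivity)
      rw [hb]; nlinarith
    have h3 : b ^ (k + 1) ≤ a / 2 := by
      rw [pow_succ]
      have := pow_le_one₀ (n := k) hb0.le hb1
      nlinarith
    calc D ^ 2 * b ^ (k + 1 + d) * (1 + y ^ 2) ^ d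
        = D ^ 2 * (b ^ (k + 1) * (b ^ d * (1 + y ^ 2) ^ d)) := by ring
      _ ≤ 1 * (a / 2 * y ^ (2 * d)) := by gcongr
      _ ≤ _ := by linarith
  · obtain ⟨z, hz, hmin⟩ := (isCompact_Icc (a := -R) (b := R)).exists_isMinOn
      ⟨0, by constructor <;> linarith⟩ (q.continuous.continuousOn (s := Set.Icc (-R) R))
    have hzR : |z| ≤ R := abs_le.2 hz
    have hm : D ^ 2 * b ^ (k + 1) ≤ q.eval z := by
      rcases hzR.lt_or_eq with hlt | heq
      · have hloc : IsLocalMin (fun y => q.eval y) z := by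
          refine IsMinOn.isLocalMin hmin (Icc_mem_nhds (abs_lt.1 hlt).1 (abs_lt.1 hlt).2)
        have hder : (derivative q).eval z = 0 := by
          have := hloc.deriv_eq_zero
          rwa [Polynomial.deriv] at this
        have h1 := congrArg (eval z) hrel
        rw [eval_add, eval_mul, eval_mul, hder, mul_zero, add_zero, eval_C] at h1
        have h2 : |D| ≤ (1 + z ^ 2) ^ k * q.eval z := by
          rw [← h1, abs_mul, abs_of_nonneg (hq z)]
          exact mul_le_mul_of_nonneg_right (hu z) (hq z)
        have h3 := hsmallw k z hzR
        calc D ^ 2 * b ^ (k + 1) = D ^ 2 * b ^ k * b := by ring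
          _ ≤ |D| * b ^ k * 1 := by gcongr
          _ ≤ ((1 + z ^ 2) ^ k * q.eval z) * b ^ k * 1 := by gcongr
          _ = ((1 + z ^ 2) ^ k * b ^ k) * q.eval z := by ring
          _ ≤ 1 * q.eval z := mul_le_mul_of_nonneg_right h3 (hq z)
          _ = _ := one_mul _
      · have h1 := hlarge z heq.ge
        have h2 : 1 ≤ z ^ (2 * d) := by
          rw [← Even.pow_abs (n := 2 * d) ⟨d, by ring⟩, heq]; exact one_le_pow₀ hR1
        have h3 : b ^ (k + 1) ≤ a / 2 := by
          rw [pow_succ]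
          have := pow_le_one₀ (n := k) hb0.le hb1
          nlinarith
        calc D ^ 2 * b ^ (k + 1) ≤ 1 * (a / 2) := by gcongr
          _ ≤ a / 2 * z ^ (2 * d) := by nlinarith
          _ ≤ _ := h1
    have h3 := hsmallw d y hy
    calc D ^ 2 * b ^ (k + 1 + d) * (1 + y ^ 2) ^ d
        = D ^ 2 * b ^ (k + 1) * ((1 + y ^ 2) ^ d * b ^ d) := by ring
      _ ≤ D ^ 2 * b ^ (k + 1) * 1 := by gcongr
      _ ≤ q.eval z := by linarith
      _ ≤ _ := hmin (abs_le.1 hy)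

end Strip

end Part4

section Part5

open Polynomial

namespace Strip

theorem squarefree_map (f : ℝ[X][X]) (hf : Squarefree f) :
    Squarefree (f.map (algebraMap ℝ[X] (FractionRing ℝ[X]))) := by
  intro w hw
  have hf0 : f ≠ 0 := hf.ne_zero
  have hm0 : f.map (algebraMap ℝ[X] (FractionRing ℝ[X])) ≠ 0 :=
    (Polynomial.map_ne_zero_iff (IsFractionRing.injective _ _)).2 hf0
  have hw0 : w ≠ 0 := by
    rintro rfl
    rw [mul_zero, zero_dvd_iff] at hw
    exact hm0 hw
  set p := IsLocalization.integerNormalization (nonZeroDivisors ℝ[X]) w with hp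
  let _ : NormalizedGCDMonoid ℝ[X] := Classical.choice inferInstance
  refine isUnit_or_eq_zero_of_isUnit_integerNormalization_primPart (R := ℝ[X]) (K := FractionRing ℝ[X]) hw0 ?_
  rw [← hp]
  obtain ⟨b, hb, hbw⟩ := IsLocalization.integerNormalization_spec (nonZeroDivisors ℝ[X]) w
  rw [← hp] at hbw
  have hdvd : p.primPart.map (algebraMap ℝ[X] (FractionRing ℝ[X])) ∣ w := by
    have hu : IsUnit (C (algebraMap ℝ[X] (FractionRing ℝ[X]) b)) :=
      isUnit_C.2 (IsLocalization.map_units (FractionRing ℝ[X]) (⟨b, hb⟩ : nonZeroDivisors ℝ[X]))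
    rw [← hu.dvd_mul_left (a := p.primPart.map _), ]
    have : C (algebraMap ℝ[X] (FractionRing ℝ[X]) b) * w = p.map (algebraMap ℝ[X] (FractionRing ℝ[X])) := by
      rw [hbw, Algebra.smul_def]; rfl
    rw [this]
    exact Polynomial.map_dvd _ (Dvd.intro_left _ p.eq_C_content_mul_primPart.symm)
  apply hf
  apply (p.isPrimitive_primPart.mul p.isPrimitive_primPart).dvd_of_fraction_map_dvd_fraction_map
    (K := FractionRing ℝ[X])
  rw [Polynomial.map_mul]
  exact (mul_dvd_mul hdvd hdvd).trans hw

theorem bezout (f : ℝ[X][X]) (hf : Squarefree f) : ∃ (u v : ℝ[X][X]) (D : ℝ[X]), D ≠ 0 ∧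
    u * f + v * derivative f = C D := by
  have h1 := PerfectField.separable_iff_squarefree.2 (squarefree_map f hf)
  obtain ⟨u, v, huv⟩ := h1
  obtain ⟨b, hb, hbu⟩ := IsLocalization.integerNormalization_spec (nonZeroDivisors ℝ[X]) u
  obtain ⟨c, hc, hcv⟩ := IsLocalization.integerNormalization_spec (nonZeroDivisors ℝ[X]) v
  refine ⟨C c * IsLocalization.integerNormalization (nonZeroDivisors ℝ[X]) u,
    C b * IsLocalization.integerNormalization (nonZeroDivisors ℝ[X]) v, b * c,
    mul_ne_zero (nonZeroDivisors.ne_zero hb) (nonZeroDivisors.ne_zero hc), ?_⟩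
  apply Polynomial.map_injective (algebraMap ℝ[X] (FractionRing ℝ[X])) (IsFractionRing.injective _ _)
  rw [derivative_map] at huv
  rw [Polynomial.map_add, Polynomial.map_mul, Polynomial.map_mul, Polynomial.map_mul,
    Polynomial.map_mul, hbu, hcv, map_C, map_C, map_C, Algebra.smul_def, Algebra.smul_def,
    map_mul, C_mul, Polynomial.algebraMap_apply, Polynomial.algebraMap_apply]
  linear_combination (C (algebraMap ℝ[X] (FractionRing ℝ[X]) b) * C (algebraMap ℝ[X] (FractionRing ℝ[X]) c)) * huv

theorem exists_ne_zero (p : ℝ[X]) (hp : p ≠ 0) : ∃ x ∈ Set.Icc (0:ℝ) 1, p.eval x ≠ 0 := by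
  by_contra h
  push Not at h
  exact hp (Polynomial.eq_zero_of_infinite_isRoot p
    ((Set.Icc_infinite (zero_lt_one (α := ℝ))).mono h))

theorem eval_map_eq (f : ℝ[X][X]) (x y : ℝ) :
    (f.map (evalRingHom x)).eval y = f.evalEval x y := map_evalRingHom_eval x y f

theorem squarefree_case (hloc : LocalProp) (f : ℝ[X][X]) (hf : Squarefree f)
    (h : ∀ x ∈ Set.Icc (0:ℝ) 1, ∀ y, 0 ≤ f.evalEval x y) : InQ f := by
  rcases Nat.eq_zero_or_pos f.natDegree with hdeg | hdeg
  · rw [eq_C_of_natDegree_eq_zero hdeg]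
    refine univ_unit _ fun x hx => ?_
    have := h x hx 0
    rwa [eq_C_of_natDegree_eq_zero hdeg, evalEval_C] at this
  obtain ⟨s, hs, htail⟩ := tail_bound _ hdeg f rfl
  set a := f.leadingCoeff with ha
  have ha0 : a ≠ 0 := leadingCoeff_ne_zero.2 hf.ne_zero
  have hev : Even f.natDegree := by
    obtain ⟨x, hx, hxa⟩ := exists_ne_zero a ha0
    exact (lead_sign f.natDegree hdeg (fun y => s * f.evalEval x y) (s * a.eval x)
      (mul_ne_zero hs.ne' hxa) (htail x hx).1 (htail x hx).2 (fun y => mul_nonneg hs.le (h x hx y))).1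
  obtain ⟨d, hd⟩ := hev
  rw [← two_mul] at hd
  have hd1 : 1 ≤ d := by omega
  obtain ⟨u, v, D, hD, huv⟩ := bezout f hf
  obtain ⟨B₁, hB₁, hB₁b⟩ := bound u.natDegree u (by omega)
  obtain ⟨B₂, hB₂, hB₂b⟩ := poly_bound D
  -- scaling
  set r := 1 / (B₁ / s + B₂) with hr
  have hr0 : 0 < r := by positivity
  have hr1 : r * (B₁ / s) ≤ 1 := by
    rw [hr, one_div_mul_eq_div, div_le_one (by positivity)]; linarith
  have hr2 : r * B₂ ≤ 1 := by
    rw [hr, one_div_mul_eq_div, div_le_one (by positivity)]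
    have : 0 < B₁ / s := by positivity
    linarith
  set k := u.natDegree with hk
  set c := s⁻¹ * r ^ 2 * (s ^ 2 / 2) ^ (k + 1 + d) with hc
  have hc0 : 0 < c := by positivity
  refine global hloc d _ (D * a ^ (k + 1 + d)) (mul_ne_zero hD (pow_ne_zero _ ha0)) rfl f c hc0 hd.le ?_
  intro x hx y
  rw [eval_mul, eval_pow]
  by_cases hxa : a.eval x = 0
  · rw [hxa, zero_pow (by omega)]; simpa using h x hx y
  by_cases hxD : D.eval x = 0
  · rw [hxD]; simpa using h x hx y
  have hapos : 0 < s * a.eval x := (lead_sign f.natDegree hdeg (fun y => s * f.evalEval x y) (s * a.eval x)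
      (mul_ne_zero hs.ne' hxa) (htail x hx).1 (htail x hx).2 (fun y => mul_nonneg hs.le (h x hx y))).2
  have key := slack_point d k hd1 (C s * f.map (evalRingHom x)) (C (r / s) * u.map (evalRingHom x))
    (C (r / s) * v.map (evalRingHom x)) (s * a.eval x) (r * D.eval x) hapos
    (by have := (htail x hx).1; rwa [abs_of_pos hapos] at this) (mul_ne_zero hr0.ne' hxD)
    (by
      rw [abs_mul, abs_of_pos hr0]
      exact le_trans (mul_le_mul_of_nonneg_left (hB₂b x hx) hr0.le) hr2)
    (by
      intro y hy
      rw [eval_mul, eval_C, eval_map_eq, ← hd]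
      exact (htail x hx).2 y hy)
    (by
      intro y
      rw [eval_mul, eval_C, eval_map_eq, abs_mul, abs_of_pos (by positivity)]
      calc _ ≤ r / s * (B₁ * (1 + y ^ 2) ^ k) := by gcongr; exact hB₁b x hx y
        _ = r * (B₁ / s) * (1 + y ^ 2) ^ k := by ring
        _ ≤ 1 * (1 + y ^ 2) ^ k := by gcongr
        _ = _ := one_mul _)
    (by
      have h1 := congrArg (Polynomial.map (evalRingHom x)) huv
      rw [Polynomial.map_add, Polynomial.map_mul, Polynomial.map_mul, map_C, ← derivative_map] at h1
      have h2 : (C (r / s) * C s : ℝ[X]) = C r := by rw [← C_mul]; congr 1; field_simp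
      rw [derivative_C_mul, C_mul]
      have h3 : (evalRingHom x) D = D.eval x := rfl
      rw [h3] at h1
      linear_combination C r * h1 + (map (evalRingHom x) u * map (evalRingHom x) f + map (evalRingHom x) v * derivative (map (evalRingHom x) f)) * h2)
    (by
      intro y
      rw [eval_mul, eval_C, eval_map_eq]
      exact mul_nonneg hs.le (h x hx y)) y
  rw [eval_mul, eval_C, eval_map_eq] at key
  have e : c * (D.eval x * a.eval x ^ (k + 1 + d)) ^ 2 * (1 + y ^ 2) ^ d =
      s⁻¹ * ((r * D.eval x) ^ 2 * ((s * a.eval x) ^ 2 / 2) ^ (k + 1 + d) * (1 + y ^ 2) ^ d) := by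
    have e1 : (s * a.eval x) ^ 2 / 2 = (s ^ 2 / 2) * (a.eval x) ^ 2 := by ring
    rw [hc, e1, mul_pow (s ^ 2 / 2)]; ring
  rw [e, inv_mul_le_iff₀ hs]
  exact key

theorem nonneg_of_sq_mul (u k : ℝ[X][X]) (hu : u ≠ 0)
    (h : ∀ x ∈ Set.Icc (0:ℝ) 1, ∀ y, 0 ≤ (u * u * k).evalEval x y) :
    ∀ x ∈ Set.Icc (0:ℝ) 1, ∀ y, 0 ≤ k.evalEval x y := by
  have hl : u.leadingCoeff ≠ 0 := leadingCoeff_ne_zero.2 hu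
  have h1 : ∀ y, ∀ x ∈ Set.Icc (0:ℝ) 1, 0 ≤ (eval (C y) k).eval x := by
    intro y
    refine nonneg_of_dense (by rw [interior_Icc, closure_Ioo (by norm_num)]) hl ?_
    intro x hx hxl
    change 0 ≤ evalEval x y k
    have h2 : ∀ y ∈ Set.univ, 0 ≤ (k.map (evalRingHom x)).eval y := by
      refine nonneg_of_dense (by simp) (w := u.map (evalRingHom x)) ?_ ?_
      · intro h0
        apply hxl
        have := congrArg (fun p => p.coeff u.natDegree) h0
        simpa [coeff_map] using this
      · intro y _ hy
        have := h x hx y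
        rw [eval_map_eq] at hy ⊢
        rw [evalEval_mul, evalEval_mul] at this
        exact nonneg_of_mul_nonneg_right this (mul_self_pos.2 hy)
    have := h2 y (Set.mem_univ _)
    rwa [eval_map_eq] at this
  exact fun x hx y => h1 y x hx

theorem main_bi (hloc : LocalProp) (f : ℝ[X][X])
    (h : ∀ x ∈ Set.Icc (0:ℝ) 1, ∀ y, 0 ≤ f.evalEval x y) : InQ f := by
  induction f using WellFounded.induction (wellFounded_dvdNotUnit (α := ℝ[X][X])) with
  | _ f ih =>
  by_cases hf0 : f = 0
  · rw [hf0]; exact InQ.zero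
  by_cases hf : Squarefree f
  · exact squarefree_case hloc f hf h
  rw [Squarefree] at hf
  push Not at hf
  obtain ⟨u, ⟨k, rfl⟩, hu⟩ := hf
  have hu0 : u ≠ 0 := by rintro rfl; simp at hf0
  have hk0 : k ≠ 0 := by rintro rfl; simp at hf0
  have := ih k ⟨hk0, u * u, fun h => hu (isUnit_of_mul_isUnit_left h), mul_comm _ _⟩
    (nonneg_of_sq_mul u k hu0 h)
  rw [← pow_two]
  exact (InQ.sq u).mul this

end Strip

end Part5

section Part6

open Polynomial
open scoped PowerSeries

namespace Strip

theorem scale_root {A B : Type*} [CommRing A] [CommRing B] (f g : A[X]) (n : ℕ)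
    (hf : f.natDegree ≤ n) (hg : g.natDegree ≤ n) (τ : A)
    (h : ∀ i ≤ n, f.coeff i = τ ^ (n - i) * g.coeff i) (φ : A →+* B) (γ : B) :
    (f.map φ).eval (φ τ * γ) = φ τ ^ n * (g.map φ).eval γ := by
  rw [eval_map, eval_map, eval₂_eq_sum_range' φ (Nat.lt_succ_of_le hf),
    eval₂_eq_sum_range' φ (Nat.lt_succ_of_le hg), Finset.mul_sum]
  refine Finset.sum_congr rfl fun i hi => ?_
  have hi' : i ≤ n := Nat.lt_succ_iff.1 (Finset.mem_range.1 hi)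
  rw [h i hi', map_mul, map_pow, mul_pow]
  obtain ⟨j, rfl⟩ := Nat.exists_eq_add_of_le hi'
  rw [Nat.add_sub_cancel_left]
  ring

theorem ps_factor {k : Type*} [Field k] (b : k⟦X⟧) (hb : b ≠ 0) :
    ∃ (v : ℕ) (u : k⟦X⟧), b = PowerSeries.X ^ v * u ∧ PowerSeries.constantCoeff u ≠ 0 := by
  refine ⟨b.order.toNat, PowerSeries.divXPowOrder b, PowerSeries.X_pow_order_mul_divXPowOrder.symm, ?_⟩
  rw [PowerSeries.constantCoeff_divXPowOrder]
  exact PowerSeries.coeff_order hb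

instance adicC (k : Type*) [Field k] : IsAdicComplete (IsLocalRing.maximalIdeal k⟦X⟧) k⟦X⟧ := by
  rw [PowerSeries.maximalIdeal_eq_span_X]; infer_instance

theorem weier {k : Type*} [Field k] (g : k⟦X⟧[X])
    (h0 : PowerSeries.constantCoeff (g.coeff 0) = 0) (i : ℕ)
    (hi : PowerSeries.constantCoeff (g.coeff i) ≠ 0) :
    ∃ D h : k⟦X⟧[X], D.Monic ∧ 1 ≤ D.natDegree ∧ D.natDegree ≤ i ∧ g = D * h := by
  have hres : ∀ a : k⟦X⟧, IsLocalRing.residue k⟦X⟧ a = 0 ↔ PowerSeries.constantCoeff a = 0 := by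
    intro a
    rw [IsLocalRing.residue_eq_zero_iff, PowerSeries.maximalIdeal_eq_span_X,
      Ideal.mem_span_singleton, PowerSeries.X_dvd_iff]
  have hc : ∀ j, PowerSeries.coeff j ((g : PowerSeries k⟦X⟧).map (IsLocalRing.residue k⟦X⟧)) =
      IsLocalRing.residue k⟦X⟧ (g.coeff j) := by
    intro j; rw [PowerSeries.coeff_map, Polynomial.coeff_coe]
  have hne : (g : PowerSeries k⟦X⟧).map (IsLocalRing.residue k⟦X⟧) ≠ 0 := by
    intro h
    have := hc i
    rw [h, map_zero] at this
    exact hi ((hres _).1 this.symm)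
  obtain ⟨D, u, H⟩ := PowerSeries.exists_isWeierstrassFactorization hne
  have hDm : D.Monic := H.isDistinguishedAt.monic
  have hdeg := H.natDegree_eq_toNat_order_map
  have hle : D.natDegree ≤ i := by
    rw [hdeg]
    apply ENat.toNat_le_of_le_coe
    apply PowerSeries.order_le
    rw [hc]
    exact fun h => hi ((hres _).1 h)
  have hge : 1 ≤ D.natDegree := by
    by_contra hlt
    have h1 : D.natDegree = 0 := by omega
    have h2 := PowerSeries.coeff_order hne
    rw [← hdeg, h1, hc] at h2
    exact h2 ((hres _).2 h0)
  have hdvd : D ∣ g := by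
    rw [← modByMonic_eq_zero_iff_dvd hDm]
    have hD : (D : PowerSeries k⟦X⟧).map (IsLocalRing.residue k⟦X⟧) ≠ 0 := by
      rw [← Polynomial.polynomial_map_coe]
      exact_mod_cast D.map_monic_ne_zero (f := IsLocalRing.residue k⟦X⟧) hDm
    have hdegD : ((D : PowerSeries k⟦X⟧).map (IsLocalRing.residue k⟦X⟧)).order.toNat = D.natDegree := by
      have H' : (D : PowerSeries k⟦X⟧).IsWeierstrassFactorization D 1 :=
        ⟨H.isDistinguishedAt, isUnit_one, by simp⟩
      exact H'.natDegree_eq_toNat_order_map.symm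
    have d1 : (g : PowerSeries k⟦X⟧).IsWeierstrassDivision (D : PowerSeries k⟦X⟧) u 0 :=
      ⟨by simpa using WithBot.bot_lt_coe _, by simpa using H.eq_mul⟩
    have d2 : (g : PowerSeries k⟦X⟧).IsWeierstrassDivision (D : PowerSeries k⟦X⟧)
        ((g /ₘ D : k⟦X⟧[X]) : PowerSeries k⟦X⟧) (g %ₘ D) := by
      refine ⟨?_, ?_⟩
      · have := degree_modByMonic_lt g hDm
        rw [degree_eq_natDegree hDm.ne_zero] at this
        erw [hdegD]
        exact this
      · rw [← Polynomial.coe_mul, ← Polynomial.coe_add, add_comm, modByMonic_add_div g D]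
    exact (d2.elim hD d1).2
  obtain ⟨h, hh⟩ := hdvd
  exact ⟨D, h, hDm, hge, hle, hh⟩

end Strip

end Part6

section Part7

open Polynomial
open scoped PowerSeries

namespace Strip

/-- The substitution `t ↦ t ^ N` as a ring homomorphism. -/
noncomputable def ex {k : Type*} [Field k] (N : ℕ) (hN : N ≠ 0) : k⟦X⟧ →+* k⟦X⟧ :=
  (PowerSeries.expand (R := k) N hN : k⟦X⟧ →ₐ[k] k⟦X⟧).toRingHom

theorem ex_apply {k : Type*} [Field k] (N : ℕ) (hN : N ≠ 0) (b : k⟦X⟧) :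
    ex N hN b = PowerSeries.expand N hN b := rfl

theorem ex_X {k : Type*} [Field k] (N : ℕ) (hN : N ≠ 0) :
    ex N hN (PowerSeries.X : k⟦X⟧) = PowerSeries.X ^ N := PowerSeries.expand_X N hN

theorem ex_const {k : Type*} [Field k] (N : ℕ) (hN : N ≠ 0) (b : k⟦X⟧) :
    PowerSeries.constantCoeff (ex N hN b) = PowerSeries.constantCoeff b :=
  PowerSeries.constantCoeff_expand N hN b

theorem ex_ex {k : Type*} [Field k] (N M : ℕ) (hN : N ≠ 0) (hM : M ≠ 0) (b : k⟦X⟧) :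
    ex M hM (ex N hN b) = ex (M * N) (mul_ne_zero hM hN) b :=
  (PowerSeries.expand_mul M hM N hN b).symm

/-- Existence of a Puiseux root. -/
def PRoot (f : ℂ⟦X⟧[X]) : Prop :=
  ∃ (N : ℕ) (hN : N ≠ 0) (α : ℂ⟦X⟧), (f.map (ex N hN)).eval α = 0

theorem PRoot.of_dvd {f g : ℂ⟦X⟧[X]} (hfg : f ∣ g) (h : PRoot f) : PRoot g := by
  obtain ⟨N, hN, α, hα⟩ := h
  obtain ⟨k, rfl⟩ := hfg
  exact ⟨N, hN, α, by rw [Polynomial.map_mul, eval_mul, hα, zero_mul]⟩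

theorem PRoot.of_shift {f : ℂ⟦X⟧[X]} (c : ℂ⟦X⟧) (h : PRoot (f.comp (X + C c))) : PRoot f := by
  obtain ⟨N, hN, α, hα⟩ := h
  refine ⟨N, hN, α + ex N hN c, ?_⟩
  rw [Polynomial.map_comp, eval_comp] at hα
  simpa using hα

theorem PRoot.of_scale {f g : ℂ⟦X⟧[X]} (n m N : ℕ) (hN : N ≠ 0) (hf : f.natDegree ≤ n)
    (hg : g.natDegree ≤ n)
    (h : ∀ i ≤ n, ex N hN (f.coeff i) = (PowerSeries.X ^ m) ^ (n - i) * g.coeff i) (hr : PRoot g) :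
    PRoot f := by
  obtain ⟨M, hM, α, hα⟩ := hr
  have := scale_root (f.map (ex N hN)) g n (natDegree_map_le.trans hf) hg (PowerSeries.X ^ m)
    (by intro i hi; rw [coeff_map, h i hi]) (ex M hM) α
  rw [hα, mul_zero, Polynomial.map_map] at this
  refine ⟨M * N, mul_ne_zero hM hN, ex M hM (PowerSeries.X ^ m) * α, ?_⟩
  rw [← this]
  congr 2
  ext1 b
  exact (ex_ex N M hN hM b).symm

open Classical in
theorem puiseux : ∀ (n : ℕ) (f : ℂ⟦X⟧[X]), f.Monic → f.natDegree = n → 1 ≤ n → PRoot f := by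
  intro n
  induction n using Nat.strong_induction_on with
  | _ n ih =>
  -- the reduced case
  have key : ∀ f : ℂ⟦X⟧[X], f.Monic → f.natDegree = n → 1 ≤ n → f.coeff (n - 1) = 0 → PRoot f := by
    intro f hf hfn hn hcoef
    by_cases hall : ∀ i < n, f.coeff i = 0
    · refine ⟨1, one_ne_zero, 0, ?_⟩
      rw [← coeff_zero_eq_eval_zero, coeff_map, hall 0 (by omega), map_zero]
    push Not at hall
    choose! v u hvu hu using fun i => ps_factor (f.coeff i)
    set S := (Finset.range n).filter (fun i => f.coeff i ≠ 0) with hS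
    have hSne : S.Nonempty := by
      obtain ⟨i, hi, hi'⟩ := hall
      exact ⟨i, by simp [hS, hi, hi']⟩
    obtain ⟨i₀, hi₀, hmin⟩ := S.exists_min_image (fun i => (v i : ℚ) / ((n : ℚ) - i)) hSne
    have hi₀n : i₀ < n := by simp [hS] at hi₀; exact hi₀.1
    have hi₀c : f.coeff i₀ ≠ 0 := by simp [hS] at hi₀; exact hi₀.2
    obtain ⟨N, hN⟩ : ∃ N, N = n - i₀ := ⟨_, rfl⟩
    have hN0 : N ≠ 0 := by omega
    have hmin' : ∀ i < n, f.coeff i ≠ 0 → v i₀ * (n - i) ≤ N * v i := by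
      intro i hi hic
      have h1 := hmin i (by simp [hS, hi, hic])
      have p1 : (0:ℚ) < (n:ℚ) - i := by
        have : (i:ℚ) < n := by exact_mod_cast hi
        linarith
      have p2 : (0:ℚ) < (n:ℚ) - i₀ := by
        have : (i₀:ℚ) < n := by exact_mod_cast hi₀n
        linarith
      rw [div_le_div_iff₀ p2 p1] at h1
      have e1 : ((n - i : ℕ) : ℚ) = (n:ℚ) - i := by rw [Nat.cast_sub hi.le]
      have e2 : ((N : ℕ) : ℚ) = (n:ℚ) - i₀ := by rw [hN, Nat.cast_sub hi₀n.le]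
      have : ((v i₀ * (n - i) : ℕ) : ℚ) ≤ ((N * v i : ℕ) : ℚ) := by
        rw [Nat.cast_mul, Nat.cast_mul, e1, e2]; linarith
      exact_mod_cast this
    obtain ⟨m, hm⟩ : ∃ m, m = v i₀ := ⟨_, rfl⟩
    rw [← hm] at hmin'
    have hcs : ∀ i, ∃ c : ℂ⟦X⟧, (i ≤ n → ex N hN0 (f.coeff i) = (PowerSeries.X ^ m) ^ (n - i) * c) ∧
        (f.coeff i = 0 → c = 0) ∧ (i = n → c = 1) ∧ (i = i₀ → PowerSeries.constantCoeff c ≠ 0) := by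
      intro i
      by_cases hic : f.coeff i = 0
      · refine ⟨0, fun _ => by rw [hic, map_zero, mul_zero], fun _ => rfl, ?_, ?_⟩
        · rintro rfl
          rw [← hfn, hf.coeff_natDegree] at hic
          exact absurd hic one_ne_zero
        · rintro rfl; exact absurd hic hi₀c
      rcases lt_trichotomy i n with hlt | heq | hgt
      · obtain ⟨j, hj⟩ := Nat.exists_eq_add_of_le (hmin' i hlt hic)
        refine ⟨PowerSeries.X ^ j * ex N hN0 (u i), fun _ => ?_, fun h => absurd h hic,
          fun h => absurd h hlt.ne, ?_⟩
        · conv_lhs => rw [hvu i hic, map_mul, map_pow, ex_X, ← pow_mul, hj]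
          rw [pow_add, ← pow_mul, mul_assoc]
        · rintro rfl
          have : j = 0 := by
            rw [← hm, ← hN, mul_comm] at hj; omega
          rw [this, pow_zero, one_mul, ex_const]
          exact hu i hic
      · refine ⟨1, fun _ => ?_, fun h => absurd h hic, fun _ => rfl, fun h => absurd h (by omega)⟩
        have hfc : f.coeff n = 1 := by rw [← hfn]; exact hf.coeff_natDegree
        rw [heq, hfc, map_one, Nat.sub_self, pow_zero, mul_one]
      · exact absurd (coeff_eq_zero_of_natDegree_lt (by omega)) hic
    choose c hc1 hc2 hc3 hc4 using hcs
    set g : ℂ⟦X⟧[X] := ∑ i ∈ Finset.range (n + 1), C (c i) * X ^ i with hg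
    have hgc : ∀ i, g.coeff i = if i < n + 1 then c i else 0 := by
      intro i
      rw [hg, finsetSum_coeff]
      simp only [coeff_C_mul_X_pow]
      rw [Finset.sum_ite_eq]
      simp
    have hgdeg : g.natDegree ≤ n := by
      rw [natDegree_le_iff_coeff_eq_zero]
      intro i hi
      rw [hgc, if_neg (by omega)]
    have hgn : g.coeff n = 1 := by rw [hgc, if_pos (by omega), hc3 n rfl]
    have hgn1 : g.coeff (n - 1) = 0 := by rw [hgc, if_pos (by omega), hc2 _ hcoef]
    have hgi : PowerSeries.constantCoeff (g.coeff i₀) ≠ 0 := by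
      rw [hgc, if_pos (by omega)]; exact hc4 _ rfl
    refine PRoot.of_scale n m N hN0 hfn.le hgdeg (fun i hi => ?_) ?_
    · rw [hc1 i hi, hgc, if_pos (by omega)]
    have hgm : g.Monic := monic_of_natDegree_le_of_coeff_eq_one n hgdeg hgn
    have hgdeg' : g.natDegree = n := natDegree_eq_of_le_of_coeff_ne_zero hgdeg (by rw [hgn]; exact one_ne_zero)
    -- reduction
    set gb := g.map (PowerSeries.constantCoeff (R := ℂ)) with hgb
    have hgbm : gb.Monic := hgm.map _
    have hgbdeg : gb.natDegree = n := by rw [hgb, hgm.natDegree_map, hgdeg']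
    obtain ⟨z, hz⟩ := IsAlgClosed.exists_root gb (by
      rw [degree_eq_natDegree hgbm.ne_zero, hgbdeg]; exact_mod_cast (by omega : n ≠ 0))
    apply PRoot.of_shift (PowerSeries.C z)
    set g₁ := g.comp (X + C (PowerSeries.C z)) with hg₁
    have hg₁b : g₁.map (PowerSeries.constantCoeff (R := ℂ)) = gb.comp (X + C z) := by
      rw [hg₁, Polynomial.map_comp, ← hgb]; simp
    have hg₁m : (gb.comp (X + C z)).Monic := hgbm.comp_X_add_C z
    have hg₁deg : (gb.comp (X + C z)).natDegree = n := by
      rw [natDegree_comp, natDegree_X_add_C, mul_one, hgbdeg]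
    obtain ⟨i, hin, hi⟩ : ∃ i < n, (gb.comp (X + C z)).coeff i ≠ 0 := by
      by_contra hcon
      push Not at hcon
      have e : gb.comp (X + C z) = X ^ n := by
        ext i
        rcases lt_trichotomy i n with h | h | h
        · rw [hcon i h, coeff_X_pow, if_neg h.ne]
        · have := hg₁m.coeff_natDegree
          rw [hg₁deg] at this
          rw [h, this, coeff_X_pow, if_pos rfl]
        · rw [coeff_eq_zero_of_natDegree_lt (by omega), coeff_X_pow, if_neg (by omega)]
      have e2 : gb = (X - C z) ^ n := by
        have := congrArg (fun p => p.comp (X - C z)) e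
        simpa [comp_assoc] using this
      have e3 : gb.coeff (n - 1) = 0 := by rw [hgb, coeff_map, hgn1, map_zero]
      have e4 : gb.nextCoeff = 0 := by
        rw [nextCoeff_of_natDegree_pos (by omega), hgbdeg, e3]
      have e5 : z = 0 := by
        rw [e2, (monic_X_sub_C z).nextCoeff_pow, nextCoeff_X_sub_C] at e4
        have hn' : (n : ℂ) ≠ 0 := by exact_mod_cast (by omega : n ≠ 0)
        simpa [hn', show n ≠ 0 by omega] using e4
      rw [e5, C_0, sub_zero] at e2
      apply hgi
      rw [← coeff_map, ← hgb, e2, coeff_X_pow, if_neg hi₀n.ne]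
    obtain ⟨D, h, hDm, hD1, hDi, hgD⟩ := weier g₁
      (by rw [← coeff_map, hg₁b, coeff_zero_eq_eval_zero, eval_comp]; simpa using hz) i
      (by rw [← coeff_map, hg₁b]; exact hi)
    exact PRoot.of_dvd ⟨h, hgD⟩ (ih D.natDegree (by omega) D hDm rfl hD1)
  intro f hf hfn hn
  have hn0 : (n : ℂ) ≠ 0 := by exact_mod_cast (by omega : n ≠ 0)
  set c : ℂ⟦X⟧ := -(PowerSeries.C ((n : ℂ)⁻¹) * f.coeff (n - 1)) with hc
  apply PRoot.of_shift c
  have hm : (f.comp (X + C c)).Monic := hf.comp_X_add_C c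
  have hd : (f.comp (X + C c)).natDegree = n := by
    rw [natDegree_comp, natDegree_X_add_C, mul_one, hfn]
  refine key _ hm hd hn ?_
  have : (f.comp (X + C c)).coeff (n - 1) = f.coeff (n - 1) + n * c := by
    have hfc : f.coeff n = 1 := by rw [← hfn]; exact hf.coeff_natDegree
    obtain ⟨l, rfl⟩ : ∃ l, n = l + 1 := ⟨n - 1, by omega⟩
    rw [← taylor_apply, taylor_coeff, eval_eq_sum_range' (n := 2)
      (lt_of_le_of_lt (natDegree_hasseDeriv_le f _) (by omega)), Finset.sum_range_succ,
      Finset.sum_range_one, hasseDeriv_coeff, hasseDeriv_coeff]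
    simp only [Nat.add_sub_cancel]
    rw [zero_add, add_comm 1 l, hfc]
    simp
  rw [this, hc]
  have h2 : (n : ℂ⟦X⟧) = PowerSeries.C (n : ℂ) := by simp
  rw [h2, mul_neg, ← mul_assoc, ← map_mul, mul_inv_cancel₀ hn0, map_one, one_mul, add_neg_cancel]

end Strip

end Part7

section Part8

open Polynomial
open scoped PowerSeries

namespace Strip

/-- Coefficientwise complex conjugation of power series. -/
noncomputable def cj : ℂ⟦X⟧ →+* ℂ⟦X⟧ := PowerSeries.map (starRingEnd ℂ)

theorem cj_cj (b : ℂ⟦X⟧) : cj (cj b) = b := by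
  ext n; simp [cj]

theorem cj_rescale (c : ℂ) (b : ℂ⟦X⟧) :
    cj (PowerSeries.rescale c b) = PowerSeries.rescale (starRingEnd ℂ c) (cj b) := by
  ext n; simp [cj, PowerSeries.coeff_rescale]

theorem cj_ex (N : ℕ) (hN : N ≠ 0) (b : ℂ⟦X⟧) : cj (ex N hN b) = ex N hN (cj b) := by
  rw [ex_apply, ex_apply, cj, PowerSeries.map_expand]

theorem rescale_ex {k : Type*} [Field k] (N : ℕ) (hN : N ≠ 0) (c : k) (b : k⟦X⟧) :
    PowerSeries.rescale c (ex N hN b) = ex N hN (PowerSeries.rescale (c ^ N) b) := by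
  ext n
  rw [PowerSeries.coeff_rescale, ex_apply, ex_apply, PowerSeries.coeff_expand, PowerSeries.coeff_expand]
  split_ifs with h
  · obtain ⟨m, rfl⟩ := h
    rw [PowerSeries.coeff_rescale, Nat.mul_div_cancel_left _ (Nat.pos_of_ne_zero hN), pow_mul]
  · rw [mul_zero]

theorem rescale_rescale' {k : Type*} [Field k] (c e : k) (b : k⟦X⟧) :
    PowerSeries.rescale c (PowerSeries.rescale e b) = PowerSeries.rescale (c * e) b := by
  ext n; simp only [PowerSeries.coeff_rescale]; ring

theorem descend {N : ℕ} (hN : N ≠ 0) {ζ : ℂ} (hζ : IsPrimitiveRoot ζ N) (c : ℂ⟦X⟧)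
    (hc : PowerSeries.rescale ζ c = c) : ∃ b, ex N hN b = c := by
  refine ⟨PowerSeries.mk fun n => PowerSeries.coeff (N * n) c, ?_⟩
  ext n
  rw [ex_apply, PowerSeries.coeff_expand]
  split_ifs with h
  · obtain ⟨m, rfl⟩ := h
    rw [PowerSeries.coeff_mk, Nat.mul_div_cancel_left _ (Nat.pos_of_ne_zero hN)]
  · have h1 := congrArg (PowerSeries.coeff n) hc
    rw [PowerSeries.coeff_rescale] at h1
    have h2 : ζ ^ n ≠ 1 := fun h' => h ((hζ.pow_eq_one_iff_dvd n).1 h')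
    have h3 : (ζ ^ n - 1) * PowerSeries.coeff n c = 0 := by linear_combination h1
    exact ((mul_eq_zero.1 h3).resolve_left (sub_ne_zero.2 h2)).symm

theorem coprime_clear_aux (K : Type) [Field K] [Algebra ℂ⟦X⟧ K] [IsFractionRing ℂ⟦X⟧ K] (h G : ℂ⟦X⟧[X]) (hm : h.Monic) (hirr : Irreducible h) (hnd : ¬ h ∣ G) :
    ∃ (u v : ℂ⟦X⟧[X]) (D : ℂ⟦X⟧), D ≠ 0 ∧ u * h + v * G = C D := by
  have h1 : Irreducible (h.map (algebraMap ℂ⟦X⟧ K)) :=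
    (hm.irreducible_iff_irreducible_map_fraction_map (K := K)).1 hirr
  have h2 : ¬ h.map (algebraMap ℂ⟦X⟧ K) ∣ G.map (algebraMap ℂ⟦X⟧ K) :=
    fun hd => hnd (hm.isPrimitive.dvd_of_fraction_map_dvd_fraction_map (K := K) hd)
  obtain ⟨u, v, huv⟩ := (h1.coprime_iff_not_dvd).2 h2
  obtain ⟨b, hb, hbu⟩ := IsLocalization.integerNormalization_spec (nonZeroDivisors ℂ⟦X⟧) u
  obtain ⟨c, hc, hcv⟩ := IsLocalization.integerNormalization_spec (nonZeroDivisors ℂ⟦X⟧) v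
  refine ⟨C c * IsLocalization.integerNormalization (nonZeroDivisors ℂ⟦X⟧) u,
    C b * IsLocalization.integerNormalization (nonZeroDivisors ℂ⟦X⟧) v, b * c,
    mul_ne_zero (nonZeroDivisors.ne_zero hb) (nonZeroDivisors.ne_zero hc), ?_⟩
  apply Polynomial.map_injective (algebraMap ℂ⟦X⟧ K) (IsFractionRing.injective _ _)
  rw [Polynomial.map_add, Polynomial.map_mul, Polynomial.map_mul, Polynomial.map_mul,
    Polynomial.map_mul, hbu, hcv, map_C, map_C, map_C, Algebra.smul_def, Algebra.smul_def,
    map_mul, C_mul, Polynomial.algebraMap_apply, Polynomial.algebraMap_apply]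
  linear_combination (C (algebraMap ℂ⟦X⟧ K b) * C (algebraMap ℂ⟦X⟧ K c)) * huv

theorem coprime_clear (h G : ℂ⟦X⟧[X]) (hm : h.Monic) (hirr : Irreducible h) (hnd : ¬ h ∣ G) :
    ∃ (u v : ℂ⟦X⟧[X]) (D : ℂ⟦X⟧), D ≠ 0 ∧ u * h + v * G = C D :=
  coprime_clear_aux (FractionRing ℂ⟦X⟧) h G hm hirr hnd

theorem ex_injective {k : Type*} [Field k] (N : ℕ) (hN : N ≠ 0) :
    Function.Injective (ex (k := k) N hN) := by
  intro a b hab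
  ext n
  have := congrArg (PowerSeries.coeff (N * n)) hab
  rwa [ex_apply, ex_apply, PowerSeries.coeff_expand_mul, PowerSeries.coeff_expand_mul] at this

theorem conj_root (N : ℕ) (hN : N ≠ 0) (ζ : ℂ) (hζ : IsPrimitiveRoot ζ N) (h : ℂ⟦X⟧[X]) (hm : h.Monic)
    (hirr : Irreducible h) (α γ : ℂ⟦X⟧) (hα : (h.map (ex N hN)).eval α = 0)
    (hγ : (h.map (ex N hN)).eval γ = 0) : ∃ k : ℕ, γ = PowerSeries.rescale (ζ ^ k) α := by
  set a : ℕ → ℂ⟦X⟧[X] := fun k => X - C (PowerSeries.rescale (ζ ^ k) α) with ha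
  set G' := ∏ k ∈ Finset.range N, a k with hG'
  have hinv : G'.map (PowerSeries.rescale ζ) = G' := by
    have h1 : G'.map (PowerSeries.rescale ζ) = ∏ k ∈ Finset.range N, a (k + 1) := by
      rw [hG', Polynomial.map_prod]
      refine Finset.prod_congr rfl fun k _ => ?_
      rw [ha]
      simp only [Polynomial.map_sub, map_X, map_C, rescale_rescale', pow_succ']
    have h2 : (∏ k ∈ Finset.range N, a (k + 1)) * a 0 = (∏ k ∈ Finset.range N, a k) * a N := by
      rw [← Finset.prod_range_succ', Finset.prod_range_succ]
    have h3 : a N = a 0 := by rw [ha]; simp only [hζ.pow_eq_one, pow_zero]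
    rw [h3] at h2
    rw [h1, hG']
    exact mul_right_cancel₀ (X_sub_C_ne_zero _) h2
  obtain ⟨G, hG⟩ : ∃ G : ℂ⟦X⟧[X], G.map (ex N hN) = G' := by
    have : G' ∈ lifts (ex N hN) := by
      rw [lifts_iff_coeff_lifts]
      intro n
      obtain ⟨b, hb⟩ := descend hN hζ (G'.coeff n) (by
        conv_rhs => rw [← hinv]
        rw [coeff_map])
      exact ⟨b, hb⟩
    exact (mem_lifts _).1 this
  have hdvd : h ∣ G := by
    by_contra hnd
    obtain ⟨u, v, D, hD, huv⟩ := coprime_clear h G hm hirr hnd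
    have h1 := congrArg (fun p => (p.map (ex N hN)).eval α) huv
    simp only [Polynomial.map_add, Polynomial.map_mul, eval_add, eval_mul, hα, mul_zero, zero_add,
      map_C, eval_C, hG] at h1
    have h2 : G'.eval α = 0 := by
      rw [hG', eval_prod]
      refine Finset.prod_eq_zero (i := 0) (by simp; omega) ?_
      simp [ha]
    rw [h2, mul_zero] at h1
    exact hD (ex_injective N hN (by rw [← h1, map_zero]))
  have h1 : G'.eval γ = 0 := by
    rw [← hG]
    obtain ⟨w, rfl⟩ := hdvd
    rw [Polynomial.map_mul, eval_mul, hγ, zero_mul]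
  rw [hG', eval_prod, Finset.prod_eq_zero_iff] at h1
  obtain ⟨k, _, hk⟩ := h1
  refine ⟨k, ?_⟩
  simpa [ha, sub_eq_zero] using hk

/-- no real branches -/
def NB (Φ : ℂ⟦X⟧[X]) : Prop := ∀ (N : ℕ) (hN : N ≠ 0) (j : ℕ) (β : ℂ⟦X⟧), cj β = β →
  (Φ.map ((ex N hN).comp (PowerSeries.rescale ((-1 : ℂ) ^ j)))).eval β ≠ 0

theorem not_real_irred (h : ℂ⟦X⟧[X]) (hm : h.Monic) (hirr : Irreducible h) (hbar : h.map cj = h)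
    (hNB : NB h) : False := by
  obtain ⟨N, hN, α, hα⟩ := puiseux h.natDegree h hm rfl (by
    by_contra hd
    have : h = 1 := hm.natDegree_eq_zero.1 (by omega)
    rw [this] at hirr
    exact hirr.not_isUnit isUnit_one)
  have hγ : (h.map (ex N hN)).eval (cj α) = 0 := by
    have h1 := congrArg cj hα
    rw [map_zero, ← eval_map_apply, Polynomial.map_map] at h1
    have e : cj.comp (ex N hN) = (ex N hN).comp cj := by ext1 b; exact cj_ex N hN b
    rw [e, ← Polynomial.map_map, hbar] at h1
    exact h1
  obtain ⟨k, hk⟩ := conj_root N hN _ (Complex.isPrimitiveRoot_exp N hN) h hm hirr α (cj α) hα hγ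
  set ω := Complex.exp (Real.pi * Complex.I / N) with hω
  have hN' : (N : ℂ) ≠ 0 := by exact_mod_cast hN
  have hω2 : Complex.exp (2 * Real.pi * Complex.I / N) = ω ^ 2 := by
    rw [hω, ← Complex.exp_nat_mul]; congr 1; push_cast; ring
  have hωN : ω ^ N = -1 := by
    rw [hω, ← Complex.exp_nat_mul, mul_div_cancel₀ _ hN', Complex.exp_pi_mul_I]
  have hωc : (starRingEnd ℂ) ω * ω = 1 := by
    rw [hω, ← Complex.exp_conj, ← Complex.exp_add]
    have : (starRingEnd ℂ) (Real.pi * Complex.I / N) + Real.pi * Complex.I / N = 0 := by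
      simp [neg_div]
    rw [this, Complex.exp_zero]
  rw [hω2] at hk
  refine hNB N hN k (PowerSeries.rescale (ω ^ k) α) ?_ ?_
  · rw [cj_rescale, hk, rescale_rescale', map_pow]
    congr 1
    have : ((starRingEnd ℂ) ω) ^ k * (ω ^ 2) ^ k = ((starRingEnd ℂ) ω * ω) ^ k * ω ^ k := by
      rw [mul_pow]; ring
    rw [this, hωc, one_pow, one_mul]
  · have h1 := congrArg (PowerSeries.rescale (ω ^ k)) hα
    rw [map_zero, ← eval_map_apply, Polynomial.map_map] at h1
    have e : (PowerSeries.rescale (ω ^ k)).comp (ex N hN) = (ex N hN).comp (PowerSeries.rescale ((-1 : ℂ) ^ k)) := by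
      ext1 b
      rw [RingHom.comp_apply, RingHom.comp_apply, rescale_ex, ← pow_mul, mul_comm k N, pow_mul, hωN]
    rw [e] at h1
    exact h1

theorem NB.of_dvd {f g : ℂ⟦X⟧[X]} (hfg : f ∣ g) (h : NB g) : NB f := by
  intro N hN j β hβ h0
  obtain ⟨k, rfl⟩ := hfg
  exact h N hN j β hβ (by rw [Polynomial.map_mul, eval_mul, h0, zero_mul])

theorem norm_form : ∀ (n : ℕ) (Φ : ℂ⟦X⟧[X]), Φ.natDegree = n → Φ.Monic → Φ.map cj = Φ → NB Φ →
    ∃ h : ℂ⟦X⟧[X], h.Monic ∧ Φ = h * h.map cj := by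
  intro n
  induction n using Nat.strong_induction_on with
  | _ n ih =>
  intro Φ hn hm hbar hNB
  rcases Nat.eq_zero_or_pos n with h0 | hpos
  · refine ⟨1, monic_one, ?_⟩
    rw [hm.natDegree_eq_zero.1 (hn.trans h0)]; simp
  have hnu : ¬ IsUnit Φ := fun hu => by
    rw [hm.isUnit_iff] at hu
    rw [hu, natDegree_one] at hn
    omega
  obtain ⟨p, hp, hpd⟩ := WfDvdMonoid.exists_irreducible_factor hnu hm.ne_zero
  obtain ⟨h, hhm, hirr, hhd⟩ : ∃ h : ℂ⟦X⟧[X], h.Monic ∧ Irreducible h ∧ h ∣ Φ := by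
    obtain ⟨q, hq⟩ := hpd
    have hl : p.leadingCoeff * q.leadingCoeff = 1 := by
      rw [← leadingCoeff_mul, ← hq]; exact hm
    have hu : IsUnit (C q.leadingCoeff) := isUnit_C.2 (IsUnit.of_mul_eq_one_right _ hl)
    refine ⟨C q.leadingCoeff * p, ?_, (irreducible_isUnit_mul hu).2 hp, ?_⟩
    · rw [Monic, leadingCoeff_mul, leadingCoeff_C, mul_comm, hl]
    · rw [hu.mul_left_dvd]; exact ⟨q, hq⟩
  by_cases hh : h.map cj = h
  · exact (not_real_irred h hhm hirr hh (hNB.of_dvd hhd)).elim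
  have hcjcj : ∀ g : ℂ⟦X⟧[X], (g.map cj).map cj = g := by
    intro g
    rw [Polynomial.map_map]
    have : cj.comp cj = RingHom.id _ := by ext1 b; exact cj_cj b
    rw [this, Polynomial.map_id]
  have hirr' : Irreducible (h.map cj) := by
    have e : ℂ⟦X⟧ ≃+* ℂ⟦X⟧ := RingEquiv.ofRingHom cj cj (by ext1 b; exact cj_cj b) (by ext1 b; exact cj_cj b)
    refine ⟨fun hu => hirr.not_isUnit ?_, fun a b hab => ?_⟩
    · have := hu.map (mapRingHom cj)
      rwa [coe_mapRingHom, hcjcj] at this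
    · have h1 := congrArg (Polynomial.map cj) hab
      rw [hcjcj, Polynomial.map_mul] at h1
      rcases hirr.isUnit_or_isUnit h1 with hu | hu
      · left
        have := hu.map (mapRingHom cj)
        rwa [coe_mapRingHom, hcjcj] at this
      · right
        have := hu.map (mapRingHom cj)
        rwa [coe_mapRingHom, hcjcj] at this
  have hhm' : (h.map cj).Monic := hhm.map _
  obtain ⟨k, hk⟩ := hhd
  have hd2 : h.map cj ∣ h * k := by
    rw [← hk, ← hbar]; exact Polynomial.map_dvd _ ⟨k, hk⟩
  obtain ⟨k', hk'⟩ : h.map cj ∣ k := by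
    rcases hirr'.prime.dvd_or_dvd hd2 with h1 | h1
    · have := hirr'.associated_of_dvd hirr h1
      exact absurd (eq_of_monic_of_associated hhm' hhm this) hh
    · exact h1
  have hΦ : Φ = h * h.map cj * k' := by rw [hk, hk', mul_assoc]
  have hprodm : (h * h.map cj).Monic := hhm.mul hhm'
  have hk'm : k'.Monic := hprodm.of_mul_monic_left (by rw [← hΦ]; exact hm)
  have hk'b : k'.map cj = k' := by
    have h1 := congrArg (Polynomial.map cj) hΦ
    rw [hbar, Polynomial.map_mul, Polynomial.map_mul, hcjcj, mul_comm (h.map cj) h, hΦ] at h1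
    exact (mul_left_cancel₀ hprodm.ne_zero h1).symm
  have hdegh : 0 < h.natDegree := by
    by_contra hd
    have : h = 1 := hhm.natDegree_eq_zero.1 (by omega)
    rw [this] at hirr
    exact hirr.not_isUnit isUnit_one
  have hdeg : k'.natDegree < n := by
    rw [← hn, hΦ, hprodm.natDegree_mul hk'm, hhm.natDegree_mul hhm']
    omega
  obtain ⟨g, hgm, hg⟩ := ih _ hdeg k' rfl hk'm hk'b (hNB.of_dvd ⟨_, by rw [hΦ, mul_comm]⟩)
  refine ⟨h * g, hhm.mul hgm, ?_⟩
  rw [hΦ, Polynomial.map_mul]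
  conv_lhs => rw [hg]
  ring

end Strip

end Part8

section Part9

open Polynomial
open scoped PowerSeries

namespace Strip

/-- Real power series as complex ones. -/
noncomputable def io : ℝ⟦X⟧ →+* ℂ⟦X⟧ := PowerSeries.map Complex.ofRealHom

/-- Real polynomials as power series. -/
noncomputable def cp : ℝ[X] →+* ℝ⟦X⟧ := Polynomial.coeToPowerSeries.ringHom

theorem cp_apply (f : ℝ[X]) : cp f = (f : ℝ⟦X⟧) := rfl

theorem io_injective : Function.Injective io :=
  PowerSeries.map_injective _ Complex.ofReal_injective

theorem cp_injective : Function.Injective cp := Polynomial.coe_injective ℝ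

theorem cj_io (r : ℝ⟦X⟧) : cj (io r) = io r := by
  ext n; simp [cj, io]

theorem real_lift (b : ℂ⟦X⟧) (h : cj b = b) : ∃ r, io r = b := by
  refine ⟨PowerSeries.mk fun n => (PowerSeries.coeff n b).re, ?_⟩
  ext n
  have h1 := congrArg (PowerSeries.coeff n) h
  simp only [cj, PowerSeries.coeff_map] at h1
  simp only [io, PowerSeries.coeff_map, PowerSeries.coeff_mk]
  exact Complex.conj_eq_iff_re.1 h1

theorem poly_lift (f : ℂ⟦X⟧[X]) (h : f.map cj = f) :
    ∃ g : ℝ⟦X⟧[X], g.map io = f ∧ g.natDegree = f.natDegree := by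
  have : f ∈ lifts io := by
    rw [lifts_iff_coeff_lifts]
    intro n
    obtain ⟨r, hr⟩ := real_lift (f.coeff n) (by
      conv_rhs => rw [← h]
      rw [coeff_map])
    exact ⟨r, hr⟩
  obtain ⟨g, hg⟩ := (mem_lifts _).1 this
  exact ⟨g, hg, by rw [← hg, natDegree_map_eq_of_injective io_injective]⟩

theorem norm_real (F : ℝ⟦X⟧[X]) (hm : F.Monic) (d : ℕ) (hd : F.natDegree = 2 * d)
    (hNB : NB (F.map io)) : ∃ U V : ℝ⟦X⟧[X], U.natDegree ≤ d ∧ V.natDegree ≤ d ∧ F = U ^ 2 + V ^ 2 := by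
  have hcj : cj.comp io = io := by ext1 b; exact cj_io b
  obtain ⟨h, hhm, hh⟩ := norm_form _ (F.map io) rfl (hm.map _) (by rw [Polynomial.map_map, hcj]) hNB
  have hcjcj : (h.map cj).map cj = h := by
    rw [Polynomial.map_map]
    have : cj.comp cj = RingHom.id _ := by ext1 b; exact cj_cj b
    rw [this, Polynomial.map_id]
  have hhd : h.natDegree = d := by
    have h1 := congrArg natDegree hh
    rw [natDegree_map_eq_of_injective io_injective, hhm.natDegree_mul (hhm.map _), hhm.natDegree_map, hd] at h1
    omega
  have hhd' : (h.map cj).natDegree ≤ d := hhd ▸ natDegree_map_le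
  set c : ℂ⟦X⟧ := PowerSeries.C (1 / 2) with hc
  set e : ℂ⟦X⟧ := PowerSeries.C (1 / (2 * Complex.I)) with he
  have hcc : cj c = c := by
    rw [hc, cj, PowerSeries.map_C, map_div₀, map_one, map_ofNat]
  have hee : cj e = - e := by
    rw [he, cj, PowerSeries.map_C, ← map_neg]
    congr 1
    simp [map_ofNat (starRingEnd ℂ) 2]
  obtain ⟨U, hU, hUd⟩ := poly_lift (C c * (h + h.map cj)) (by
    rw [Polynomial.map_mul, Polynomial.map_add, map_C, hcc, hcjcj, add_comm])
  obtain ⟨V, hV, hVd⟩ := poly_lift (C e * (h - h.map cj)) (by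
    rw [Polynomial.map_mul, Polynomial.map_sub, map_C, hee, hcjcj, C_neg]; ring)
  refine ⟨U, V, ?_, ?_, ?_⟩
  · rw [hUd]
    exact (natDegree_C_mul_le _ _).trans ((natDegree_add_le _ _).trans (max_le hhd.le hhd'))
  · rw [hVd]
    exact (natDegree_C_mul_le _ _).trans ((natDegree_sub_le _ _).trans (max_le hhd.le hhd'))
  · apply Polynomial.map_injective io io_injective
    rw [Polynomial.map_add, Polynomial.map_pow, Polynomial.map_pow, hU, hV, hh]
    have h1 : (C c : ℂ⟦X⟧[X]) ^ 2 * 4 = 1 := by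
      have : (4 : ℂ⟦X⟧[X]) = C (PowerSeries.C (4 : ℂ)) := by
        rw [map_ofNat, map_ofNat]
      rw [this, hc, ← C_pow, ← C_mul, ← map_pow, ← map_mul]
      norm_num
    have h3 : (C c : ℂ⟦X⟧[X]) ^ 2 = - (C e) ^ 2 := by
      rw [hc, he, ← C_pow, ← C_pow, ← map_pow, ← map_pow, ← map_neg, ← map_neg]
      congr 2
      rw [div_pow, div_pow, mul_pow, Complex.I_sq]; norm_num
    linear_combination (-(h * h.map cj)) * h1 - (h - h.map cj) ^ 2 * h3

/-- pointwise domination near zero transfers divisibility by powers of `X` -/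
theorem dvd_of_le (δ : ℝ) (hδ : 0 < δ) : ∀ (M : ℕ) (r q : ℝ[X]),
    (∀ t, 0 < t → t < δ → |r.eval t| ≤ |q.eval t|) → X ^ M ∣ q → X ^ M ∣ r := by
  intro M
  induction M with
  | zero => intro r q _ _; simp
  | succ M ih =>
    intro r q h hq
    obtain ⟨r', hr'⟩ := ih r q h ((pow_dvd_pow _ (Nat.le_succ _)).trans hq)
    obtain ⟨q', rfl⟩ := hq
    rw [hr', pow_succ]
    refine mul_dvd_mul_left _ ?_
    rw [X_dvd_iff, coeff_zero_eq_eval_zero, ← abs_eq_zero]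
    refine le_antisymm ?_ (abs_nonneg _)
    have h1 : Filter.Tendsto (fun t => |r'.eval t|) (nhdsWithin 0 (Set.Ioi 0)) (nhds |r'.eval 0|) :=
      ((r'.continuous.abs).tendsto 0).mono_left nhdsWithin_le_nhds
    have h2 : Filter.Tendsto (fun t => |(X * q').eval t|) (nhdsWithin 0 (Set.Ioi 0)) (nhds |(X * q').eval 0|) :=
      (((X * q').continuous.abs).tendsto 0).mono_left nhdsWithin_le_nhds
    have h3 := le_of_tendsto_of_tendsto h1 h2 (by
      filter_upwards [Ioo_mem_nhdsGT hδ] with t ht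
      have := h t ht.1 ht.2
      rw [hr', pow_succ, mul_assoc, eval_mul, eval_mul, abs_mul, abs_mul] at this
      have hp : 0 < |((X : ℝ[X]) ^ M).eval t| := by
        rw [eval_pow, eval_X]; exact abs_pos.2 (pow_pos ht.1 _).ne'
      exact le_of_mul_le_mul_left this hp)
    simpa using h3

theorem cp_dvd (M : ℕ) (q : ℝ[X]) (h : PowerSeries.X ^ M ∣ cp q) : X ^ M ∣ q := by
  rw [X_pow_dvd_iff]
  rw [PowerSeries.X_pow_dvd_iff] at h
  intro i hi
  simpa [cp_apply] using h i hi

theorem exists_trunc (b : ℝ⟦X⟧) (M : ℕ) : ∃ b' : ℝ[X], PowerSeries.X ^ M ∣ b - cp b' := by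
  refine ⟨PowerSeries.trunc M b, ?_⟩
  rw [PowerSeries.X_pow_dvd_iff]
  intro i hi
  rw [map_sub, cp_apply, Polynomial.coeff_coe, PowerSeries.coeff_trunc, if_pos hi, sub_self]

theorem rescale_C' (c a : ℂ) : PowerSeries.rescale c (PowerSeries.C a) = PowerSeries.C a := by
  ext n
  rw [PowerSeries.coeff_rescale, PowerSeries.coeff_C]
  split_ifs with h
  · simp [h]
  · simp

theorem ex_C (N : ℕ) (hN : N ≠ 0) (a : ℂ) : ex N hN (PowerSeries.C a) = PowerSeries.C a := by
  rw [ex_apply, PowerSeries.expand_C]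

theorem NB_of_bound (F1 : ℝ[X][X]) (R : ℝ[X]) (hR : R ≠ 0) (δ : ℝ) (hδ : 0 < δ)
    (h : ∀ x, |x| < δ → ∀ y, |R.eval x| ≤ |F1.evalEval x y|) : NB ((F1.map cp).map io) := by
  intro N hN j β hβ h0
  obtain ⟨β', rfl⟩ := real_lift β hβ
  set c : ℝ := (-1) ^ j with hc
  set τ : ℝ[X] →+* ℝ[X] := compRingHom (C c * X ^ N) with hτ
  have hcomp : (((ex N hN).comp (PowerSeries.rescale ((-1 : ℂ) ^ j))).comp io).comp cp
      = (io.comp cp).comp τ := by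
    apply Polynomial.ringHom_ext
    · intro a
      simp only [RingHom.comp_apply, cp_apply, hτ, coe_compRingHom, C_comp, io, Polynomial.coe_C, PowerSeries.map_C]
      rw [rescale_C', ex_C]
    · simp only [RingHom.comp_apply, cp_apply, hτ, coe_compRingHom_apply, X_comp, io, Polynomial.coe_X,
        PowerSeries.map_X, Polynomial.coe_mul, Polynomial.coe_pow, Polynomial.coe_C, map_mul, map_pow, PowerSeries.map_C]
      rw [PowerSeries.rescale_X, map_mul, ex_X, ex_C]
      simp [hc]
  rw [Polynomial.map_map, Polynomial.map_map, hcomp, RingHom.comp_assoc, ← Polynomial.map_map,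
    eval_map_apply] at h0
  have h1 : (F1.map (cp.comp τ)).eval β' = 0 := io_injective (by rw [h0, map_zero])
  set r := R.comp (C c * X ^ N) with hr
  have hc0 : c ≠ 0 := pow_ne_zero _ (by norm_num)
  have hcabs : |c| = 1 := by rw [hc, abs_pow]; simp
  have hr0 : r ≠ 0 := by
    intro h2
    rw [hr, comp_eq_zero_iff] at h2
    rcases h2 with h2 | ⟨_, h2⟩
    · exact hR h2
    · have := congrArg natDegree h2
      rw [natDegree_C_mul_X_pow _ _ hc0, natDegree_C] at this
      exact hN this
  obtain ⟨b, hb⟩ := exists_trunc β' (r.natDegree + 1)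
  set q := (F1.map τ).eval b with hq
  have hqd : X ^ (r.natDegree + 1) ∣ q := by
    apply cp_dvd
    have h2 := sub_dvd_eval_sub β' (cp b) (F1.map (cp.comp τ))
    rw [h1, zero_sub, dvd_neg, ← Polynomial.map_map, eval_map_apply] at h2
    exact hb.trans h2
  have hqe : ∀ t, q.eval t = F1.evalEval (c * t ^ N) (b.eval t) := by
    intro t
    rw [← eval_map_eq, hq]
    have h2 := (eval_map_apply (p := F1.map τ) (f := evalRingHom t) (x := b)).symm
    rw [Polynomial.map_map] at h2
    have h3 : (evalRingHom t).comp τ = evalRingHom (c * t ^ N) := by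
      apply Polynomial.ringHom_ext
      · intro a; simp [hτ]
      · simp [hτ]
    rw [h3] at h2
    exact h2
  have hle : ∀ t, 0 < t → t < min δ 1 → |r.eval t| ≤ |q.eval t| := by
    intro t ht0 ht
    rw [hqe, hr, eval_comp]
    have : (C c * X ^ N : ℝ[X]).eval t = c * t ^ N := by simp
    rw [this]
    apply h
    rw [abs_mul, hcabs, one_mul, abs_of_pos (pow_pos ht0 _)]
    have h4 : t ^ N ≤ t := pow_le_of_le_one ht0.le (ht.le.trans (min_le_right _ _)) hN
    exact h4.trans_lt (ht.trans_le (min_le_left _ _))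
  have h5 := dvd_of_le (min δ 1) (lt_min hδ one_pos) _ r q hle hqd
  have h6 := natDegree_le_of_dvd h5 hr0
  rw [natDegree_X_pow] at h6
  omega

end Strip

end Part9

section Part10

open Polynomial
open scoped PowerSeries

namespace Strip

theorem top_coeff_nonneg (G : ℝ[X]) (n : ℕ) (hn : G.natDegree ≤ n) (h : ∀ y, 0 ≤ G.eval y) :
    0 ≤ G.coeff n := by
  by_contra hlt
  push Not at hlt
  have hd : G.natDegree = n := le_antisymm hn (le_natDegree_of_ne_zero hlt.ne)
  rcases Nat.eq_zero_or_pos n with h0 | hpos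
  · subst h0
    rw [coeff_zero_eq_eval_zero] at hlt
    exact absurd (h 0) (not_le.2 hlt)
  · have h1 : 0 < G.degree := natDegree_pos_iff_degree_pos.1 (hd ▸ hpos)
    have h2 := G.tendsto_atBot_of_leadingCoeff_nonpos h1 (by rw [leadingCoeff, hd]; exact hlt.le)
    obtain ⟨y, hy⟩ := (h2.eventually (Filter.eventually_lt_atBot 0)).exists
    exact absurd (h y) (not_le.2 hy)

theorem top_coeff_bound (G : ℝ[X]) (d : ℕ) (hn : G.natDegree ≤ 2 * d) (c : ℝ)
    (h : ∀ y, c * (1 + y ^ 2) ^ d ≤ G.eval y) : c ≤ G.coeff (2 * d) := by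
  have hW1 : ((1 + X ^ 2 : ℝ[X])).Monic := by
    rw [add_comm]; exact monic_X_pow_add (by rw [degree_one]; norm_num)
  have hW2 : ((1 + X ^ 2 : ℝ[X])).natDegree = 2 := by
    rw [add_comm]; simpa using natDegree_X_pow_add_C (n := 2) (r := (1 : ℝ))
  have hWm := hW1.pow d
  have hWd : ((1 + X ^ 2 : ℝ[X]) ^ d).natDegree = 2 * d := by
    rw [hW1.natDegree_pow, hW2, mul_comm]
  have h1 := top_coeff_nonneg (G - C c * (1 + X ^ 2) ^ d) (2 * d)
    ((natDegree_sub_le _ _).trans (max_le hn ((natDegree_C_mul_le _ _).trans hWd.le))) (by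
      intro y
      have := h y
      simp only [eval_sub, eval_mul, eval_C, eval_pow, eval_add, eval_one, eval_X]
      linarith)
  have h2 : ((1 + X ^ 2 : ℝ[X]) ^ d).coeff (2 * d) = 1 := by
    rw [← hWd]; exact hWm
  rw [coeff_sub, coeff_C_mul, h2] at h1
  linarith

theorem sqrt_unit (e : ℝ⟦X⟧) (he : 0 < PowerSeries.constantCoeff e) : ∃ s, s ^ 2 = e := by
  set c := PowerSeries.constantCoeff e with hc
  have hmem : ∀ g : ℝ⟦X⟧, g ∈ IsLocalRing.maximalIdeal ℝ⟦X⟧ ↔ PowerSeries.constantCoeff g = 0 := by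
    intro g
    rw [PowerSeries.maximalIdeal_eq_span_X, Ideal.mem_span_singleton, PowerSeries.X_dvd_iff]
  obtain ⟨s, hs, _⟩ := HenselianRing.is_henselian (I := IsLocalRing.maximalIdeal ℝ⟦X⟧)
    (X ^ 2 - C e) (monic_X_pow_sub_C e (by norm_num)) (PowerSeries.C (Real.sqrt c)) (by
      rw [hmem]
      simp [Real.sq_sqrt he.le, ← hc]) (by
      apply IsUnit.map
      rw [PowerSeries.isUnit_iff_constantCoeff]
      simp
      exact (Real.sqrt_pos.2 he).ne')
  refine ⟨s, ?_⟩
  simpa [IsRoot, sub_eq_zero] using hs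

theorem sqrt_poly (δ : ℝ) (hδ : 0 < δ) : ∀ (n : ℕ) (a : ℝ[X]), a.natDegree ≤ n → a ≠ 0 →
    (∀ t, t ≠ 0 → |t| < δ → 0 ≤ a.eval t) → ∃ b, b ^ 2 = cp a := by
  have right : ∀ a : ℝ[X], (∀ t, 0 < t → t < δ → 0 ≤ a.eval t) → 0 ≤ a.eval 0 := by
    intro a ha
    have h1 : Filter.Tendsto (fun t => a.eval t) (nhdsWithin 0 (Set.Ioi 0)) (nhds (a.eval 0)) :=
      (a.continuous.tendsto 0).mono_left nhdsWithin_le_nhds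
    refine ge_of_tendsto h1 ?_
    filter_upwards [Ioo_mem_nhdsGT hδ] with t ht using ha t ht.1 ht.2
  intro n
  induction n using Nat.strong_induction_on with
  | _ n ih =>
  intro a hn ha0 ha
  have ha00 : 0 ≤ a.eval 0 := right a fun t h0 h1 => ha t h0.ne' (by rwa [abs_of_pos h0])
  rcases ha00.lt_or_eq with hpos | hz
  · exact sqrt_unit _ (by
      rw [← PowerSeries.coeff_zero_eq_constantCoeff_apply, cp_apply, Polynomial.coeff_coe,
        coeff_zero_eq_eval_zero]
      exact hpos)
  obtain ⟨a', rfl⟩ : X ∣ a := by rw [X_dvd_iff, coeff_zero_eq_eval_zero, ← hz]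
  have h1 : 0 ≤ a'.eval 0 := by
    refine right a' fun t h0 h1 => ?_
    have := ha t h0.ne' (by rwa [abs_of_pos h0])
    rw [eval_mul, eval_X] at this
    exact nonneg_of_mul_nonneg_right this h0
  have h2 : 0 ≤ (-(a'.comp (-X))).eval 0 := by
    refine right _ fun t h0 h1 => ?_
    have := ha (-t) (by simpa using h0.ne') (by rwa [abs_neg, abs_of_pos h0])
    rw [eval_mul, eval_X] at this
    rw [eval_neg, eval_comp, eval_neg, eval_X]
    by_contra hc
    nlinarith
  have h3 : a'.eval 0 = 0 := by
    rw [eval_neg, eval_comp, eval_neg, eval_X, neg_zero] at h2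
    linarith
  obtain ⟨a'', rfl⟩ : X ∣ a' := by rw [X_dvd_iff, coeff_zero_eq_eval_zero, h3]
  have ha'' : a'' ≠ 0 := by rintro rfl; simp at ha0
  have hdeg : (X * (X * a'')).natDegree = a''.natDegree + 1 + 1 := by
    rw [natDegree_X_mul (mul_ne_zero X_ne_zero ha''), natDegree_X_mul ha'']
  obtain ⟨b, hb⟩ := ih a''.natDegree (by omega) a'' le_rfl ha'' (by
    intro t ht0 ht
    have := ha t ht0 ht
    rw [eval_mul, eval_mul, eval_X, ← mul_assoc] at this
    exact nonneg_of_mul_nonneg_right this (mul_self_pos.2 ht0))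
  refine ⟨cp X * b, ?_⟩
  rw [mul_pow, hb, map_mul, map_mul]; ring

theorem cancel_X (G A B : ℝ⟦X⟧[X]) (d : ℕ) (hA : A.natDegree ≤ d) (hB : B.natDegree ≤ d)
    (h : C (PowerSeries.X) ^ 2 * G = A ^ 2 + B ^ 2) :
    ∃ A' B' : ℝ⟦X⟧[X], A'.natDegree ≤ d ∧ B'.natDegree ≤ d ∧ G = A' ^ 2 + B' ^ 2 := by
  have h1 := congrArg (Polynomial.map (PowerSeries.constantCoeff (R := ℝ))) h
  rw [Polynomial.map_mul, Polynomial.map_pow, map_C, Polynomial.map_add, Polynomial.map_pow,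
    Polynomial.map_pow, PowerSeries.constantCoeff_X, C_0, zero_pow two_ne_zero, zero_mul] at h1
  have hdiv : ∀ P : ℝ⟦X⟧[X], P.map (PowerSeries.constantCoeff (R := ℝ)) = 0 → P.natDegree ≤ d →
      ∃ P', P = C PowerSeries.X * P' ∧ P'.natDegree ≤ d := by
    intro P hP hd
    obtain ⟨P', hP'⟩ : C PowerSeries.X ∣ P := by
      rw [C_dvd_iff_dvd_coeff]
      intro i
      rw [PowerSeries.X_dvd_iff, ← coeff_map, hP, coeff_zero]
    refine ⟨P', hP', ?_⟩
    rw [hP', natDegree_C_mul PowerSeries.X_ne_zero] at hd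
    exact hd
  have hev : ∀ y, (A.map (PowerSeries.constantCoeff (R := ℝ))).eval y = 0 ∧
      (B.map (PowerSeries.constantCoeff (R := ℝ))).eval y = 0 := by
    intro y
    have h2 := congrArg (eval y) h1
    rw [eval_zero, eval_add, eval_pow, eval_pow] at h2
    constructor <;> nlinarith [sq_nonneg ((A.map (PowerSeries.constantCoeff (R := ℝ))).eval y),
      sq_nonneg ((B.map (PowerSeries.constantCoeff (R := ℝ))).eval y)]
  obtain ⟨A', rfl, hA'⟩ := hdiv A (Polynomial.funext fun y => by rw [(hev y).1, eval_zero]) hA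
  obtain ⟨B', rfl, hB'⟩ := hdiv B (Polynomial.funext fun y => by rw [(hev y).2, eval_zero]) hB
  refine ⟨A', B', hA', hB', ?_⟩
  have hX : (C PowerSeries.X : ℝ⟦X⟧[X]) ^ 2 ≠ 0 := pow_ne_zero _ (C_ne_zero.2 PowerSeries.X_ne_zero)
  apply mul_left_cancel₀ hX
  rw [h]; ring

theorem cancel (b : ℝ⟦X⟧) (hb : b ≠ 0) (G A B : ℝ⟦X⟧[X]) (d : ℕ) (hA : A.natDegree ≤ d)
    (hB : B.natDegree ≤ d) (h : C b ^ 2 * G = A ^ 2 + B ^ 2) :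
    ∃ A' B' : ℝ⟦X⟧[X], A'.natDegree ≤ d ∧ B'.natDegree ≤ d ∧ G = A' ^ 2 + B' ^ 2 := by
  obtain ⟨v, u, rfl, hu⟩ := ps_factor b hb
  induction v generalizing A B with
  | zero =>
    obtain ⟨w, hw⟩ := isUnit_iff_exists_inv.1 (PowerSeries.isUnit_iff_constantCoeff.2 (isUnit_iff_ne_zero.2 hu))
    refine ⟨C w * A, C w * B, (natDegree_C_mul_le _ _).trans hA, (natDegree_C_mul_le _ _).trans hB, ?_⟩
    have hw' : (C u : ℝ⟦X⟧[X]) * C w = 1 := by rw [← C_mul, hw, C_1]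
    rw [pow_zero, one_mul] at h
    linear_combination (C w) ^ 2 * h - G * (C u * C w + 1) * hw'
  | succ v ih =>
    have hX : (PowerSeries.X : ℝ⟦X⟧) ^ v * u ≠ 0 := by
      intro h0; apply hb; rw [pow_succ]; linear_combination PowerSeries.X * h0
    obtain ⟨A', B', hA', hB', h'⟩ := cancel_X (C (PowerSeries.X ^ v * u) ^ 2 * G) A B d hA hB (by
      rw [← h, pow_succ PowerSeries.X v]; simp only [C_mul]; ring)
    exact ih A' B' hA' hB' hX h'

theorem local_thm (d : ℕ) (F : ℝ[X][X]) (hF : F.natDegree ≤ 2 * d) (p : ℝ[X]) (hp : p ≠ 0)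
    (δ : ℝ) (hδ : 0 < δ)
    (h : ∀ t, |t| < δ → ∀ y, (p.eval t) ^ 2 * (1 + y ^ 2) ^ d ≤ F.evalEval t y) :
    ∃ U V : ℝ⟦X⟧[X], U.natDegree ≤ d ∧ V.natDegree ≤ d ∧ F.map cp = U ^ 2 + V ^ 2 := by
  set a := F.coeff (2 * d) with ha
  have hap : ∀ t, |t| < δ → (p.eval t) ^ 2 ≤ a.eval t := by
    intro t ht
    have := top_coeff_bound (F.map (evalRingHom t)) d (natDegree_map_le.trans hF) ((p.eval t) ^ 2) (by
      intro y; rw [eval_map_eq]; exact h t ht y)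
    rwa [coeff_map] at this
  have ha0 : a ≠ 0 := by
    intro h0
    apply hp
    apply Polynomial.eq_zero_of_infinite_isRoot
    refine (Set.Ioo_infinite hδ).mono fun t ht => ?_
    have := hap t (by rw [abs_of_pos ht.1]; exact ht.2)
    rw [h0, eval_zero] at this
    exact pow_eq_zero_iff two_ne_zero |>.1 (le_antisymm this (sq_nonneg _))
  have hdeg : F.natDegree = 2 * d := le_antisymm hF (le_natDegree_of_ne_zero ha0)
  have hlc : F.leadingCoeff = a := by rw [leadingCoeff, hdeg]
  have hF0 : F ≠ 0 := by rintro rfl; simp [ha] at ha0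
  obtain ⟨b, hb⟩ := sqrt_poly δ hδ _ a le_rfl ha0 fun t _ ht => (sq_nonneg _).trans (hap t ht)
  have hb0 : b ≠ 0 := by
    rintro rfl
    apply ha0
    apply cp_injective
    rw [← hb, map_zero]; simp
  rcases Nat.eq_zero_or_pos d with hd0 | hdpos
  · subst hd0
    refine ⟨C b, 0, by simp, by simp, ?_⟩
    rw [eq_C_of_natDegree_eq_zero hdeg, map_C, ← C_pow, hb]
    simp [ha]
  have hdeg1 : 1 ≤ F.natDegree := by omega
  set F1 := integralNormalization F with hF1
  have hNB : NB ((F1.map cp).map io) := by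
    refine NB_of_bound F1 (a ^ (2 * d - 1) * p ^ 2) (mul_ne_zero (pow_ne_zero _ ha0) (pow_ne_zero _ hp)) δ hδ ?_
    intro x hx y
    rw [eval_mul, eval_pow, eval_pow]
    by_cases hax : a.eval x = 0
    · rw [hax, zero_pow (by omega)]; simp
    have h1 := integralNormalization_eval₂_leadingCoeff_mul hdeg1 (evalRingHom x) (y / a.eval x)
    rw [← eval_map, ← eval_map, eval_map_eq, eval_map_eq, hlc, coe_evalRingHom, mul_div_cancel₀ _ hax, hdeg] at h1
    rw [h1, abs_mul, abs_mul]
    refine mul_le_mul_of_nonneg_left ?_ (abs_nonneg _)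
    have h2 := h x hx (y / a.eval x)
    have h3 : 1 ≤ (1 + (y / a.eval x) ^ 2) ^ d := one_le_pow₀ (by nlinarith [sq_nonneg (y / a.eval x)])
    rw [abs_of_nonneg (sq_nonneg _)]
    refine le_trans ?_ (le_abs_self _)
    nlinarith [sq_nonneg (p.eval x)]
  obtain ⟨U, V, hU, hV, hUV⟩ := norm_real (F1.map cp) ((monic_integralNormalization hF0).map _) d (by
    rw [natDegree_map_eq_of_injective cp_injective, hF1, natDegree_integralNormalization, hdeg]) hNB
  have hcomp : (F1.map cp).comp (C (cp a) * X) = C (cp a) ^ (2 * d - 1) * F.map cp := by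
    ext1 i
    rw [comp_C_mul_X_coeff, ← C_pow, coeff_C_mul, coeff_map, coeff_map, ← map_pow, ← map_pow, ← map_mul, ← map_mul]
    congr 1
    have := integralNormalization_coeff_mul_leadingCoeff_pow (p := F) i hdeg1
    rw [hlc, hdeg] at this
    rw [this, mul_comm]
  have hcd : ∀ P : ℝ⟦X⟧[X], P.natDegree ≤ d → (C b * P.comp (C (cp a) * X)).natDegree ≤ d := by
    intro P hP
    refine (natDegree_C_mul_le _ _).trans (natDegree_comp_le.trans ?_)
    calc P.natDegree * (C (cp a) * X).natDegree ≤ P.natDegree * 1 :=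
          Nat.mul_le_mul_left _ ((natDegree_C_mul_le _ _).trans natDegree_X_le)
      _ ≤ d := by omega
  refine cancel (b ^ (2 * d)) (pow_ne_zero _ hb0) (F.map cp) _ _ d (hcd U hU) (hcd V hV) ?_
  have h5 : C (b ^ (2 * d)) ^ 2 = C b ^ 2 * C (cp a) ^ (2 * d - 1) := by
    rw [← hb, ← C_pow, ← C_pow, ← C_pow, ← C_mul]
    congr 1
    rw [← pow_mul, ← pow_mul, ← pow_add]
    congr 1; omega
  rw [h5, mul_assoc, ← hcomp, hUV, add_comp, pow_comp, pow_comp]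
  ring

theorem trunc_poly (U : ℝ⟦X⟧[X]) (d : ℕ) (hU : U.natDegree ≤ d) (M : ℕ) :
    ∃ T : ℝ[X][X], T.natDegree ≤ d ∧ C (PowerSeries.X ^ M) ∣ U - T.map cp := by
  choose t ht using fun i => exists_trunc (U.coeff i) M
  refine ⟨∑ i ∈ Finset.range (d + 1), C (t i) * X ^ i, ?_, ?_⟩
  · refine natDegree_sum_le_of_forall_le _ _ fun i hi => ?_
    exact (natDegree_C_mul_X_pow_le _ _).trans (by simp at hi; omega)
  · conv => rhs; rw [U.as_sum_range_C_mul_X_pow' (n := d + 1) (by omega)]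
    rw [Polynomial.map_sum, ← Finset.sum_sub_distrib]
    refine Finset.dvd_sum fun i _ => ?_
    rw [Polynomial.map_mul, map_C, Polynomial.map_pow, map_X, ← sub_mul, ← C_sub]
    exact Dvd.dvd.mul_right (map_dvd C (ht i)) _

theorem local_trunc (d : ℕ) (F : ℝ[X][X]) (hF : F.natDegree ≤ 2 * d) (p : ℝ[X]) (hp : p ≠ 0)
    (δ : ℝ) (hδ : 0 < δ)
    (h : ∀ t, |t| < δ → ∀ y, (p.eval t) ^ 2 * (1 + y ^ 2) ^ d ≤ F.evalEval t y) (M : ℕ) :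
    ∃ U V : ℝ[X][X], U.natDegree ≤ d ∧ V.natDegree ≤ d ∧ C (X ^ M) ∣ F - (U ^ 2 + V ^ 2) := by
  obtain ⟨U, V, hU, hV, hUV⟩ := local_thm d F hF p hp δ hδ h
  obtain ⟨U', hU', hUd⟩ := trunc_poly U d hU M
  obtain ⟨V', hV', hVd⟩ := trunc_poly V d hV M
  refine ⟨U', V', hU', hV', ?_⟩
  have h1 : C (PowerSeries.X ^ M) ∣ (F - (U' ^ 2 + V' ^ 2)).map cp := by
    have : (F - (U' ^ 2 + V' ^ 2)).map cp = (U - U'.map cp) * (U + U'.map cp) + (V - V'.map cp) * (V + V'.map cp) := by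
      rw [Polynomial.map_sub, Polynomial.map_add, Polynomial.map_pow, Polynomial.map_pow, hUV]; ring
    rw [this]
    exact dvd_add (hUd.mul_right _) (hVd.mul_right _)
  rw [C_dvd_iff_dvd_coeff] at h1 ⊢
  intro i
  have := h1 i
  rw [coeff_map] at this
  exact cp_dvd M _ this

end Strip

end Part10

section Part11

open Polynomial
open scoped PowerSeries

namespace Strip

theorem evalEval_map_comp (F : ℝ[X][X]) (g : ℝ[X]) (t y : ℝ) :
    (F.map (compRingHom g)).evalEval t y = F.evalEval (g.eval t) y := by
  rw [← eval_map_eq, ← eval_map_eq, Polynomial.map_map]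
  congr 2
  apply Polynomial.ringHom_ext
  · intro a; simp
  · simp

theorem natDegree_sos {U V : ℝ[X][X]} {d : ℕ} (hU : U.natDegree ≤ d) (hV : V.natDegree ≤ d) :
    (U ^ 2 + V ^ 2).natDegree ≤ 2 * d :=
  (natDegree_add_le _ _).trans (max_le (natDegree_pow_le_of_le 2 hU) (natDegree_pow_le_of_le 2 hV))

theorem map_comp_comp (F : ℝ[X][X]) (g h : ℝ[X]) (hgh : g.comp h = X) :
    (F.map (compRingHom g)).map (compRingHom h) = F := by
  rw [Polynomial.map_map]
  have : (compRingHom h).comp (compRingHom g) = RingHom.id _ := by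
    apply Polynomial.ringHom_ext
    · intro a; simp
    · simp [hgh]
  rw [this, Polynomial.map_id]

theorem local_interior (d : ℕ) (F : ℝ[X][X]) (hF : F.natDegree ≤ 2 * d) (P : ℝ[X]) (hP : P ≠ 0)
    (h : ∀ x ∈ Set.Icc (0:ℝ) 1, ∀ y, (P.eval x) ^ 2 * (1 + y ^ 2) ^ d ≤ F.evalEval x y) (x₀ : ℝ)
    (h0 : 0 < x₀) (h1 : x₀ < 1) (M : ℕ) :
    ∃ S : ℝ[X][X], InQ S ∧ S.natDegree ≤ 2 * d ∧ C ((X - C x₀) ^ M) ∣ F - S := by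
  obtain ⟨U, V, hU, hV, hUV⟩ := local_trunc d (F.map (compRingHom (X + C x₀))) (natDegree_map_le.trans hF)
    (P.comp (X + C x₀)) (by rwa [Ne, comp_X_add_C_eq_zero_iff]) (min x₀ (1 - x₀)) (lt_min h0 (by linarith)) (by
      intro t ht y
      obtain ⟨ht1, ht2⟩ := lt_min_iff.1 ht
      rw [evalEval_map_comp, eval_comp]
      refine h _ ?_ y
      rw [abs_lt] at ht1 ht2
      simp only [eval_add, eval_X, eval_C, Set.mem_Icc]
      constructor <;> linarith) M
  refine ⟨(U ^ 2 + V ^ 2).map (compRingHom (X - C x₀)), ?_, natDegree_map_le.trans (natDegree_sos hU hV), ?_⟩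
  · rw [Polynomial.map_add, Polynomial.map_pow, Polynomial.map_pow]
    exact (InQ.sq _).add (InQ.sq _)
  · have h2 := Polynomial.map_dvd (compRingHom (X - C x₀)) hUV
    rw [Polynomial.map_sub, map_comp_comp _ _ _ (by simp), map_C] at h2
    simpa using h2

theorem split1 (q : ℝ[X]) : ∃ a b : ℝ[X], q = expand ℝ 2 a + X * expand ℝ 2 b := by
  induction q using Polynomial.induction_on' with
  | add p q hp hq =>
    obtain ⟨a, b, rfl⟩ := hp
    obtain ⟨c, e, rfl⟩ := hq
    exact ⟨a + c, b + e, by rw [map_add, map_add]; ring⟩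
  | monomial n c =>
    rcases Nat.even_or_odd' n with ⟨k, rfl | rfl⟩
    · exact ⟨monomial k c, 0, by rw [expand_monomial]; simp [mul_comm]⟩
    · refine ⟨0, monomial k c, ?_⟩
      rw [expand_monomial, map_zero, zero_add, X_mul_monomial, mul_comm k 2]

/-- substitution `x ↦ x ^ 2` in the coefficients -/
noncomputable def kap : ℝ[X] →+* ℝ[X] := (expand ℝ 2 : ℝ[X] →ₐ[ℝ] ℝ[X]).toRingHom

theorem kap_apply (q : ℝ[X]) : kap q = expand ℝ 2 q := rfl

theorem kap_eq : kap = compRingHom (X ^ 2) := by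
  apply Polynomial.ringHom_ext
  · intro a; simp [kap_apply]
  · simp [kap_apply]

theorem split2 (U : ℝ[X][X]) (d : ℕ) (hU : U.natDegree ≤ d) :
    ∃ A B : ℝ[X][X], A.natDegree ≤ d ∧ B.natDegree ≤ d ∧ U = A.map kap + C X * B.map kap := by
  choose a b hab using fun i => split1 (U.coeff i)
  refine ⟨∑ i ∈ Finset.range (d + 1), C (a i) * X ^ i, ∑ i ∈ Finset.range (d + 1), C (b i) * X ^ i, ?_, ?_, ?_⟩
  · refine natDegree_sum_le_of_forall_le _ _ fun i hi => ?_
    exact (natDegree_C_mul_X_pow_le _ _).trans (by simp at hi; omega)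
  · refine natDegree_sum_le_of_forall_le _ _ fun i hi => ?_
    exact (natDegree_C_mul_X_pow_le _ _).trans (by simp at hi; omega)
  · conv_lhs => rw [U.as_sum_range_C_mul_X_pow' (n := d + 1) (by omega)]
    rw [Polynomial.map_sum, Polynomial.map_sum, Finset.mul_sum, ← Finset.sum_add_distrib]
    refine Finset.sum_congr rfl fun i _ => ?_
    rw [Polynomial.map_mul, Polynomial.map_mul, map_C, map_C, Polynomial.map_pow, map_X, kap_apply, kap_apply,
      hab i, C_add, C_mul]
    ring

theorem even_part (M : ℕ) (f o : ℝ[X]) (h : X ^ (2 * M) ∣ kap f - X * kap o) : X ^ M ∣ f := by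
  rw [X_pow_dvd_iff] at h ⊢
  intro j hj
  have h1 := h (2 * j) (by omega)
  rw [coeff_sub, kap_apply, kap_apply, coeff_expand_mul' (by norm_num)] at h1
  have h2 : (X * expand ℝ 2 o).coeff (2 * j) = 0 := by
    rcases j with _ | j
    · simp
    · rw [show 2 * (j + 1) = (2 * j + 1) + 1 by ring, coeff_X_mul, coeff_expand (by norm_num), if_neg (by omega)]
  rwa [h2, sub_zero] at h1

theorem local_zero (d : ℕ) (F : ℝ[X][X]) (hF : F.natDegree ≤ 2 * d) (P : ℝ[X]) (hP : P ≠ 0)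
    (h : ∀ x ∈ Set.Icc (0:ℝ) 1, ∀ y, (P.eval x) ^ 2 * (1 + y ^ 2) ^ d ≤ F.evalEval x y) (M : ℕ) :
    ∃ A B A' B' : ℝ[X][X], A.natDegree ≤ d ∧ B.natDegree ≤ d ∧ A'.natDegree ≤ d ∧ B'.natDegree ≤ d ∧
      C (X ^ M) ∣ F - ((A ^ 2 + B ^ 2) + C X * (A' ^ 2 + B' ^ 2)) := by
  obtain ⟨U, V, hU, hV, hUV⟩ := local_trunc d (F.map kap) (natDegree_map_le.trans hF)
    (kap P) (by rw [kap_apply, Ne, expand_eq_zero (by norm_num)]; exact hP) 1 one_pos (by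
      intro t ht y
      rw [kap_eq, evalEval_map_comp, coe_compRingHom_apply, eval_comp]
      refine h _ ?_ y
      rw [abs_lt] at ht
      simp only [eval_pow, eval_X, Set.mem_Icc]
      constructor <;> nlinarith) (2 * M)
  obtain ⟨A, A', hA, hA', rfl⟩ := split2 U d hU
  obtain ⟨B, B', hB, hB', rfl⟩ := split2 V d hV
  refine ⟨A, B, A', B', hA, hB, hA', hB', ?_⟩
  have hX : kap X = X ^ 2 := by simp [kap_apply]
  have key : F.map kap - ((A.map kap + C X * A'.map kap) ^ 2 + (B.map kap + C X * B'.map kap) ^ 2) =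
      (F - ((A ^ 2 + B ^ 2) + C X * (A' ^ 2 + B' ^ 2))).map kap - C X * (2 * (A * A' + B * B')).map kap := by
    simp only [Polynomial.map_sub, Polynomial.map_add, Polynomial.map_mul, Polynomial.map_pow, map_C, hX, C_pow,
      Polynomial.map_ofNat]
    ring
  rw [key, C_dvd_iff_dvd_coeff] at hUV
  rw [C_dvd_iff_dvd_coeff]
  intro i
  have := hUV i
  rw [coeff_sub, coeff_C_mul, coeff_map, coeff_map] at this
  exact even_part M _ _ this

theorem natDegree_sos2 {A B A' B' : ℝ[X][X]} {d : ℕ} (hA : A.natDegree ≤ d) (hB : B.natDegree ≤ d)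
    (hA' : A'.natDegree ≤ d) (hB' : B'.natDegree ≤ d) (g : ℝ[X]) :
    ((A ^ 2 + B ^ 2) + C g * (A' ^ 2 + B' ^ 2)).natDegree ≤ 2 * d :=
  (natDegree_add_le _ _).trans (max_le (natDegree_sos hA hB)
    ((natDegree_C_mul_le _ _).trans (natDegree_sos hA' hB')))

theorem localProp : LocalProp := by
  intro d F hF P hP h x₀ hx₀ M
  rcases hx₀.1.eq_or_lt with h0 | h0
  · subst h0
    obtain ⟨A, B, A', B', hA, hB, hA', hB', hd⟩ := local_zero d F hF P hP h M
    refine ⟨_, ?_, natDegree_sos2 hA hB hA' hB' X, by simpa using hd⟩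
    exact ((InQ.sq _).add (InQ.sq _)).add (InQ.CX.mul ((InQ.sq _).add (InQ.sq _)))
  rcases hx₀.2.eq_or_lt with h1 | h1
  · subst h1
    have hinv : ((1 - X : ℝ[X])).comp (1 - X) = X := by simp
    obtain ⟨A, B, A', B', hA, hB, hA', hB', hd⟩ := local_zero d (F.map (compRingHom (1 - X)))
      (natDegree_map_le.trans hF) (P.comp (1 - X)) (by
        intro hc
        have := congrArg (fun q => q.comp (1 - X)) hc
        simp only [comp_assoc, hinv, comp_X, zero_comp] at this
        exact hP this) (by
        intro x hx y
        rw [evalEval_map_comp, eval_comp]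
        refine h _ ?_ y
        simp only [eval_sub, eval_one, eval_X, Set.mem_Icc]
        constructor <;> linarith [hx.1, hx.2]) M
    have h2 := Polynomial.map_dvd (compRingHom (1 - X)) hd
    rw [Polynomial.map_sub, map_comp_comp _ _ _ hinv, map_C] at h2
    simp only [Polynomial.map_add, Polynomial.map_mul, Polynomial.map_pow, map_C, coe_compRingHom_apply,
      X_comp, pow_comp] at h2
    refine ⟨_, ?_, natDegree_sos2 (natDegree_map_le.trans hA) (natDegree_map_le.trans hB)
      (natDegree_map_le.trans hA') (natDegree_map_le.trans hB') (1 - X), dvd_trans ?_ h2⟩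
    · exact ((InQ.sq _).add (InQ.sq _)).add (InQ.C1X.mul ((InQ.sq _).add (InQ.sq _)))
    · apply _root_.map_dvd
      have : (X - C 1 : ℝ[X]) = (-1) * (1 - X) := by rw [C_1]; ring
      rw [this, mul_pow]
      exact ((isUnit_one.neg.pow M).mul_left_dvd).2 dvd_rfl
  · exact local_interior d F hF P hP h x₀ h0 h1 M

theorem strip_bi (f : ℝ[X][X]) (h : ∀ x ∈ Set.Icc (0:ℝ) 1, ∀ y, 0 ≤ f.evalEval x y) : InQ f :=
  main_bi localProp f h

end Strip

end Part11

open MvPolynomial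

namespace Strip

noncomputable def toBi : MvPolynomial (Fin 2) ℝ →ₐ[ℝ] Polynomial (Polynomial ℝ) :=
  aeval ![Polynomial.C Polynomial.X, Polynomial.X]

noncomputable def ofBi : Polynomial (Polynomial ℝ) →+* MvPolynomial (Fin 2) ℝ :=
  Polynomial.eval₂RingHom (Polynomial.eval₂RingHom MvPolynomial.C (X 0)) (X 1)

theorem ofBi_toBi (h : MvPolynomial (Fin 2) ℝ) : ofBi (toBi h) = h := by
  have : ofBi.comp (toBi : MvPolynomial (Fin 2) ℝ →+* Polynomial (Polynomial ℝ)) = RingHom.id _ := by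
    apply MvPolynomial.ringHom_ext
    · intro r
      simp [ofBi, toBi, Polynomial.algebraMap_apply]
    · intro i
      fin_cases i <;> simp [ofBi, toBi]
  exact congrArg (fun g => g h) this

theorem toBi_eval (h : MvPolynomial (Fin 2) ℝ) (a b : ℝ) :
    (toBi h).evalEval a b = MvPolynomial.eval ![a, b] h := by
  have : (Polynomial.evalEvalRingHom a b).comp (toBi : MvPolynomial (Fin 2) ℝ →+* Polynomial (Polynomial ℝ))
      = MvPolynomial.eval ![a, b] := by
    apply MvPolynomial.ringHom_ext
    · intro r
      simp [toBi, Polynomial.algebraMap_apply]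
    · intro i
      fin_cases i <;> simp [toBi]
  exact congrArg (fun g => g h) this

theorem isSumSq_map {R S : Type*} [CommRing R] [CommRing S] (g : R →+* S) {f : R} (hf : IsSumSq f) :
    IsSumSq (g f) := by
  induction hf with
  | zero => rw [map_zero]; exact IsSumSq.zero
  | sq_add a _ ih => rw [map_add, map_mul]; exact (IsSumSq.mul_self _).add ih

theorem isSumSq_real {f : ℝ} (hf : IsSumSq f) : 0 ≤ f := by
  induction hf with
  | zero => exact le_rfl
  | sq_add a _ ih => exact add_nonneg (mul_self_nonneg a) ih

end Strip

/-- Marshall's strip theorem: a polynomial `h ∈ ℝ[s,t]` satisfies `h(a,b) ≥ 0` for all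
`a ∈ [0,1]` and all `b ∈ ℝ` if and only if there are sums of squares `σ₁, σ₂ ∈ ℝ[s,t]`
with `h = σ₁ + σ₂·s(1-s)`. Here variable `0` is `s` and variable `1` is `t`. -/
theorem marshall_strip (h : MvPolynomial (Fin 2) ℝ) :
    (∀ a b : ℝ, a ∈ Set.Icc (0 : ℝ) 1 → 0 ≤ MvPolynomial.eval ![a, b] h) ↔
      ∃ σ₁ σ₂ : MvPolynomial (Fin 2) ℝ, IsSumSq σ₁ ∧ IsSumSq σ₂ ∧
        h = σ₁ + σ₂ * (X 0 * (1 - X 0)) := by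
  constructor
  · intro hh
    obtain ⟨s1, s2, h1, h2, he⟩ := Strip.strip_bi (Strip.toBi h) (by
      intro x hx y
      rw [Strip.toBi_eval]
      exact hh x y hx)
    refine ⟨Strip.ofBi s1, Strip.ofBi s2, Strip.isSumSq_map _ h1, Strip.isSumSq_map _ h2, ?_⟩
    have h3 := congrArg Strip.ofBi he
    rw [Strip.ofBi_toBi, map_add, map_mul] at h3
    rw [h3]
    simp [Strip.ofBi]
  · rintro ⟨s1, s2, h1, h2, rfl⟩ a b ⟨ha0, ha1⟩
    rw [map_add, map_mul]
    refine add_nonneg (Strip.isSumSq_real (Strip.isSumSq_map _ h1))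
      (mul_nonneg (Strip.isSumSq_real (Strip.isSumSq_map _ h2)) ?_)
    simpa using mul_nonneg ha0 (sub_nonneg.2 ha1)
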